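/- arXiv:0709.1297 — 3 statements merged into one kernel-verified Lean document; each statement's English description precedes it below -/
import Mathlib

section
/- Let K be a field with char K = p > 0, and let 1 → Z/pZ → G̃ → G → 1 be a group extension of finite groups (i.e. G̃ is a finite group with a normal subgroup of order p whose quotient is G). Then there exists a K-embedding ι : K(G) → K(G̃) such that K(G̃) is rational (purely transcendental) over the subfield ι(K(G)). -/
set_option synthInstance.maxHeartbeats 1000000
set_option maxHeartbeats 1000000

noncomputable section

/-- The rational function field `K(x(g) : g ∈ G)` in variables indexed by `G`. -/
abbrev NoetherBigField (K : Type*) [Field K] (G : Type*) : Type _ :=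
  FractionRing (MvPolynomial G K)

/-- The `K`-automorphism of `K(x(g) : g ∈ G)` induced by `h · x(g) = x(hg)`. -/
def noetherAut (K : Type*) [Field K] (G : Type*) [Group G] (h : G) :
    NoetherBigField K G ≃ₐ[K] NoetherBigField K G :=
  IsFractionRing.algEquivOfAlgEquiv (MvPolynomial.renameEquiv K (Equiv.mulLeft h))

/-- The fixed field `K(G) = K(x(g) : g ∈ G)^G`, as a subfield. -/
def noetherSubfield (K : Type*) [Field K] (G : Type*) [Group G] :
    Subfield (NoetherBigField K G) where
  carrier := {x | ∀ h : G, noetherAut K G h x = x}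
  mul_mem' := by intro a b ha hb h; rw [map_mul, ha h, hb h]
  one_mem' := by intro h; rw [map_one]
  add_mem' := by intro a b ha hb h; rw [map_add, ha h, hb h]
  zero_mem' := by intro h; rw [map_zero]
  neg_mem' := by intro a ha h; rw [map_neg, ha h]
  inv_mem' := by intro a ha h; rw [map_inv₀, ha h]

/-- Noether's fixed field `K(G) = K(x(g) : g ∈ G)^G`. -/
def NoetherField (K : Type*) [Field K] (G : Type*) [Group G] : Type _ :=
  noetherSubfield K G

instance (K : Type*) [Field K] (G : Type*) [Group G] : Field (NoetherField K G) :=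
  inferInstanceAs (Field (noetherSubfield K G))

theorem algebraMap_mem_noetherSubfield (K : Type*) [Field K] (G : Type*) [Group G] (c : K) :
    algebraMap K (NoetherBigField K G) c ∈ noetherSubfield K G := by
  intro h
  exact AlgEquiv.commutes _ c

instance (K : Type*) [Field K] (G : Type*) [Group G] : Algebra K (NoetherField K G) :=
  RingHom.toAlgebra <|
    ((algebraMap K (NoetherBigField K G)).codRestrict (noetherSubfield K G).toSubring
      (algebraMap_mem_noetherSubfield K G))

/-- An extension `L/F` is rational (purely transcendental) if `L` is `F`-isomorphic to a
rational function field `F(t₁, …, tₙ)` over `F` in finitely many variables. -/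
def IsRationalExtension (F L : Type*) [Field F] [Field L] [Algebra F L] : Prop :=
  ∃ n : ℕ, Nonempty (L ≃ₐ[F] FractionRing (MvPolynomial (Fin n) F))

/-- An extension `L/F` is stably rational if the rational function field `L(y₁, …, y_r)`
is rational over `F` for some finite number `r` of indeterminates. -/
def IsStablyRationalExtension (F L : Type*) [Field F] [Field L] [Algebra F L] : Prop :=
  ∃ r : ℕ, IsRationalExtension F (FractionRing (MvPolynomial (Fin r) L))


theorem grp_data (K : Type*) [Field K] (p : ℕ) (hp : p.Prime) [CharP K p]
    (Gt G : Type*) [Group Gt] [Group G]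
    (π : Gt →* G) (hsurj : Function.Surjective π) (hker : Nat.card π.ker = p) :
    ∃ (f : Gt → K) (s : G → Gt) (α : Gt → K) (c : Gt → G → K) (g1 : Gt),
      (∀ g, π (s g) = g) ∧ (∀ g, f (s g) = 0) ∧ f g1 ≠ 0 ∧ (∀ h, α h ≠ 0) ∧
      (∀ h, α h ^ p = α h) ∧ (∀ h g, f (h⁻¹ * g) = α h * f g + c h (π g)) ∧
      (∀ h, π h = 1 → ∃ d : K, (d = 0 → h = 1) ∧ d ^ p = d ∧ ∀ g, f (h⁻¹ * g) = f g + d) := by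
  have : Fact p.Prime := ⟨hp⟩
  have : Fact (Nat.card π.ker).Prime := ⟨hker ▸ hp⟩
  have : IsCyclic π.ker := isCyclic_of_prime_card hker
  have e0 : Multiplicative (ZMod (Nat.card π.ker)) ≃* π.ker := zmodCyclicMulEquiv inferInstance
  have e : Multiplicative (ZMod p) ≃* π.ker := hker ▸ e0
  let ψ : π.ker → ZMod p := fun n => (e.symm n).toAdd
  have ψmul : ∀ a b, ψ (a * b) = ψ a + ψ b := fun a b => by simp [ψ]
  have ψinj : ∀ a, ψ a = 0 → a = 1 := fun a ha => by
    have : e.symm a = 1 := by simpa [ψ] using ha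
    simpa using this
  have ψone : ψ 1 = 0 := by simp [ψ]
  have ψinv : ∀ a, ψ a⁻¹ = - ψ a := fun a => by simp [ψ]
  let n1 : π.ker := e (Multiplicative.ofAdd 1)
  have hn1 : ψ n1 = 1 := by simp [ψ, n1]
  have ψsurj : ∀ (n : π.ker), ∃ k : ℕ, n = n1 ^ k := by
    intro n
    refine ⟨(ψ n).val, ?_⟩
    apply e.symm.injective
    simp only [n1, map_pow, MulEquiv.symm_apply_apply]
    rw [← ofAdd_nsmul]
    simp [ψ]
  have ψpow : ∀ (a : π.ker) (k : ℕ), ψ (a ^ k) = k * ψ a := fun a k => by simp [ψ]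
  let cj : Gt → π.ker → π.ker := fun h n => MulAut.conjNormal h⁻¹ n
  have cjv : ∀ h n, ((cj h n : π.ker) : Gt) = h⁻¹ * n * h := fun h n => by simp [cj]
  have cjψ : ∀ h n, ψ (cj h n) = ψ (cj h n1) * ψ n := by
    intro h n
    obtain ⟨k, rfl⟩ := ψsurj n
    have : cj h (n1 ^ k) = (cj h n1) ^ k := by simp [cj]
    rw [this, ψpow, ψpow, hn1]; ring
  have cj0 : ∀ h, ψ (cj h n1) ≠ 0 := by
    intro h h0
    have h1 := ψinj _ h0
    have h2 : n1 = 1 := by simpa [cj] using h1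
    rw [h2, ψone] at hn1
    exact zero_ne_one hn1
  choose s hs using hsurj
  let q : Gt → π.ker := fun g => ⟨g * (s (π g))⁻¹, by simp [MonoidHom.mem_ker, hs]⟩
  let r : Gt → G → π.ker := fun h g => ⟨h⁻¹ * s g * (s ((π h)⁻¹ * g))⁻¹, by
    simp [MonoidHom.mem_ker, hs]⟩
  let κ : ZMod p →+* K := ZMod.castHom dvd_rfl K
  have κ0 : ∀ a, κ a = 0 → a = 0 := fun a ha => (map_eq_zero κ).1 ha
  have κp : ∀ a, κ a ^ p = κ a := fun a => by rw [← map_pow, ZMod.pow_card]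
  have key : ∀ h g, q (h⁻¹ * g) = cj h (q g) * r h (π g) := by
    intro h g
    apply Subtype.ext
    simp only [Subgroup.coe_mul, cjv, q, r, map_mul, map_inv]
    group
  refine ⟨fun g => κ (ψ (q g)), s, fun h => κ (ψ (cj h n1)), fun h g => κ (ψ (r h g)),
    n1 * s 1, hs, ?_, ?_, ?_, ?_, ?_, ?_⟩
  · intro g
    have : q (s g) = 1 := by apply Subtype.ext; simp [q, hs]
    simp [this, ψone]
  · have : q (n1 * s 1) = n1 := by
      apply Subtype.ext
      have h1 : π (n1 : Gt) = 1 := n1.2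
      simp [q, hs, h1]
    simp [this, hn1]
  · intro h h0; exact cj0 h (κ0 _ h0)
  · intro h; exact κp _
  · intro h g
    simp only [key, ψmul, cjψ h (q g), map_add, map_mul]
  · intro h hh
    refine ⟨κ (- ψ ⟨h, hh⟩), ?_, κp _, ?_⟩
    · intro h0
      have := ψinj ⟨h, hh⟩ (by simpa using κ0 _ h0)
      simpa using congrArg Subtype.val this
    · intro g
      have : q (h⁻¹ * g) = (⟨h, hh⟩ : π.ker)⁻¹ * q g := by
        apply Subtype.ext
        simp [q, hh, mul_assoc]
      simp only [this, ψmul, ψinv, map_add, map_neg]; ring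

theorem dedekind_sum {M B I : Type*} [Monoid M] [Field B] [Fintype I] (σ : I → M →* B)
    (hσ : Function.Injective σ) (b : I → B) (h : ∀ θ, ∑ i, b i * σ i θ = 0) : ∀ i, b i = 0 := by
  have := (linearIndependent_monoidHom M B).comp σ hσ
  rw [Fintype.linearIndependent_iff] at this
  apply this b
  funext θ
  simpa using h θ

/-- Speiser type lemma. -/
theorem speiser {A B Gt : Type*} [Field A] [Field B] [Algebra A B] [Group Gt] [Fintype Gt]
    [MulSemiringAction Gt B] (E : IntermediateField A B)
    (hst : ∀ h : Gt, ∀ θ ∈ E, h • θ ∈ E)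
    (hE : ∀ h : Gt, (∀ θ ∈ E, h • θ = θ) → h = 1) (x : Gt → B) (g : Gt) :
    x g ∈ Submodule.span E (Set.range fun θ : E => ∑ h, (h • (θ : B)) * x h) := by
  by_contra hx
  obtain ⟨l, hl, hle⟩ := Submodule.exists_le_ker_of_notMem hx
  apply hl
  let σ : Gt → E →* B := fun h =>
    ((MulSemiringAction.toRingHom Gt B h : B →+* B) : B →* B).comp (algebraMap E B : E →* B)
  have hσ : Function.Injective σ := by
    intro h h' hh
    have : h'⁻¹ * h = 1 := by
      apply hE
      intro θ hθ
      have := DFunLike.congr_fun hh (⟨θ, hθ⟩ : E)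
      have h2 : h • θ = h' • θ := this
      rw [mul_smul, h2, inv_smul_smul]
    exact (inv_mul_eq_one.1 this).symm
  have := dedekind_sum σ hσ (fun h => ((l (x h) : E) : B)) (by
    intro θ
    have h1 : l (∑ h, (h • (θ : B)) * x h) = 0 := hle (Submodule.subset_span ⟨θ, rfl⟩)
    have h2 : ∑ h, (h • (θ : B)) * x h = ∑ h, (⟨h • (θ : B), hst h _ θ.2⟩ : E) • x h := rfl
    rw [h2, map_sum] at h1
    have h3 := congrArg (algebraMap E B) h1
    rw [map_sum, map_zero] at h3
    rw [← h3]
    refine Finset.sum_congr rfl fun h _ => ?_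
    rw [map_smul, smul_eq_mul, map_mul, mul_comm]
    rfl)
  exact_mod_cast this g

theorem choose_inv {A B Gt : Type*} [Field A] [Field B] [Algebra A B] [Group Gt] [Fintype Gt]
    [MulSemiringAction Gt B] (E : IntermediateField A B)
    (hst : ∀ h : Gt, ∀ θ ∈ E, h • θ ∈ E)
    (hE : ∀ h : Gt, (∀ θ ∈ E, h • θ = θ) → h = 1) (x : Gt → B)
    (hx : ∀ h g, h • x g = x (h * g)) (T : Finset Gt)
    (hT : ∀ g, x g ∈ Submodule.span E (insert 1 (x '' T))) :
    ∃ m ≤ T.card, ∃ t : Fin m → B, (∀ i, ∀ h : Gt, h • t i = t i) ∧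
      ∀ g, x g ∈ Submodule.span E (insert 1 (Set.range t)) := by
  classical
  set V := Set.range fun θ : E => ∑ h, (h • (θ : B)) * x h with hV
  have h1 : LinearIndepOn E id ({1} : Set B) :=
    LinearIndepOn.singleton' (fun r hr => by
      have h : algebraMap E B r = 0 := by simpa [Algebra.smul_def] using hr
      exact (map_eq_zero _).1 h)
  obtain ⟨b, hb, h1b, hbs, hbi⟩ := exists_linearIndepOn_id_extension h1
    (Set.singleton_subset_iff.2 (Set.mem_insert 1 V))
  have h1b : (1 : B) ∈ b := by simpa using h1b
  have hinv : ∀ v ∈ V, ∀ h : Gt, h • v = v := by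
    rintro _ ⟨θ, rfl⟩ h
    simp only [Finset.smul_sum, smul_mul', hx, ← mul_smul]
    exact Fintype.sum_equiv (Equiv.mulLeft h) _ _ (fun _ => rfl)
  set W : Finset B := insert 1 (T.image x) with hW
  have hWs : (W : Set B) = insert 1 (x '' T) := by simp [hW]
  have hbW : b ⊆ Submodule.span E (W : Set B) := by
    refine hb.trans (Set.insert_subset ?_ ?_)
    · exact Submodule.subset_span (by simp [hW])
    · rintro _ ⟨θ, rfl⟩
      refine Submodule.sum_mem _ fun h _ => ?_
      rw [hWs]
      exact Submodule.smul_mem _ (⟨h • (θ : B), hst h _ θ.2⟩ : E) (hT h)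
  have hcard : Cardinal.mk b ≤ W.card := by
    have := linearIndependent_le_span' (fun v : b => (v : B)) hbi (W : Set B) (by
      rintro _ ⟨v, rfl⟩; exact hbW v.2)
    simpa using this
  have hWc : W.card ≤ T.card + 1 :=
    (Finset.card_insert_le _ _).trans (Nat.add_le_add_right Finset.card_image_le 1)
  have hfin : b.Finite := by
    rw [← Cardinal.lt_aleph0_iff_set_finite]
    exact hcard.trans_lt Cardinal.natCast_lt_aleph0
  set b' : Finset B := hfin.toFinset.erase 1 with hb'
  have hb'c : b'.card ≤ T.card := by
    have h2 : hfin.toFinset.card ≤ W.card := by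
      rw [← Set.ncard_eq_toFinset_card b hfin]
      have : (b.ncard : Cardinal) ≤ W.card := by
        rwa [Set.cast_ncard hfin]
      exact_mod_cast this
    rw [hb', Finset.card_erase_of_mem (by simpa using h1b)]
    omega
  refine ⟨b'.card, hb'c, fun i => (b'.equivFin.symm i : B), ?_, ?_⟩
  · intro i h
    have := (b'.equivFin.symm i).2
    simp only [hb', Finset.mem_erase, Set.Finite.mem_toFinset] at this
    exact hinv _ ((hb this.2).resolve_left this.1) h
  · intro g
    have h2 : V ⊆ Submodule.span E b := (Set.subset_insert _ _).trans hbs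
    have h3 := Submodule.span_le.2 h2 (speiser E hst hE x g)
    refine Submodule.span_mono ?_ h3
    intro v hv
    by_cases h : v = 1
    · exact Or.inl h
    · refine Or.inr ⟨b'.equivFin ⟨v, by simp [hb', h, hv]⟩, by simp⟩

theorem isAlg_of_top {K B : Type*} [Field K] [Field B] [Algebra K B] (S : Set B)
    (h : IntermediateField.adjoin K S = ⊤) : Algebra.IsAlgebraic (Algebra.adjoin K S) B := by
  rw [← IntermediateField.isAlgebraic_adjoin_iff_top, h]
  exact ⟨fun b => isAlgebraic_algebraMap (⟨b, trivial⟩ : (⊤ : IntermediateField K B))⟩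

theorem core_trdeg {K A0 A B Gt G : Type*} [Field K] [Field A0] [Field A] [Field B]
    [Algebra K A0] [Algebra K A] [Algebra K B] [Algebra A0 A] [Algebra A0 B]
    [IsScalarTower K A0 A] [IsScalarTower K A0 B]
    [Fintype Gt] [Fintype G] [Algebra.IsAlgebraic A0 A]
    (x : Gt → B) (hx : AlgebraicIndependent K x)
    (hxtop : IntermediateField.adjoin K (Set.range x) = ⊤)
    (X : G → A) (hX : AlgebraicIndependent K X)
    (hXtop : IntermediateField.adjoin K (Set.range X) = ⊤) :
    (Fintype.card G : Cardinal) + Algebra.trdeg A0 B = Fintype.card Gt := by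
  have bx : IsTranscendenceBasis K x := by
    rw [hx.isTranscendenceBasis_iff_isAlgebraic]
    exact isAlg_of_top _ hxtop
  have bX : IsTranscendenceBasis K X := by
    rw [hX.isTranscendenceBasis_iff_isAlgebraic]
    exact isAlg_of_top _ hXtop
  have h1 := bx.lift_cardinalMk_eq_trdeg
  have h2 := bX.lift_cardinalMk_eq_trdeg
  have h3 := lift_trdeg_add_eq K A0 B
  have h4 := lift_trdeg_add_eq K A0 A
  rw [trdeg_eq_zero (R := A0) (A := A)] at h4
  simp only [Cardinal.mk_fintype, Cardinal.lift_natCast] at h1 h2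
  have h1' := Cardinal.nat_eq_lift_iff.1 h1
  have h2' := Cardinal.nat_eq_lift_iff.1 h2
  rw [← h2'] at h4
  rw [← h1'] at h3
  simp only [Cardinal.lift_zero, add_zero, Cardinal.lift_natCast] at h4
  have h4' := Cardinal.lift_eq_nat_iff.1 h4
  rw [h4'] at h3
  simp only [Cardinal.lift_natCast] at h3
  apply Cardinal.lift_injective
  simp only [Cardinal.lift_natCast, Cardinal.lift_add]
  exact h3

theorem core_rat {A0 B F : Type*} [Field A0] [Field B] [Field F] [Algebra A0 F]
    [Algebra A0 B] [Algebra F B] [IsScalarTower A0 F B] {n : ℕ} (w : Fin n → B)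
    (hw : ∀ i, w i ∈ Set.range (algebraMap F B))
    (hgen : ∀ b : F, algebraMap F B b ∈ IntermediateField.adjoin A0 (Set.range w))
    (halg : Algebra.IsAlgebraic (IntermediateField.adjoin A0 (Set.range w)) B)
    (htr : (n : Cardinal) ≤ Algebra.trdeg A0 B) :
    Nonempty (F ≃ₐ[A0] FractionRing (MvPolynomial (Fin n) A0)) := by
  choose v hv using hw
  obtain rfl : w = fun i => algebraMap F B (v i) := funext fun i => (hv i).symm
  have htop : IntermediateField.adjoin A0 (Set.range v) = ⊤ := by
    rw [eq_top_iff]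
    intro b _
    have := hgen b
    have h2 : Set.range (fun i => algebraMap F B (v i)) =
        (IsScalarTower.toAlgHom A0 F B) '' Set.range v := by
      rw [← Set.range_comp]; rfl
    rw [h2, ← IntermediateField.adjoin_map] at this
    obtain ⟨b', hb', hbb⟩ := this
    rwa [← (algebraMap F B).injective hbb]
  rw [IntermediateField.isAlgebraic_adjoin_iff_top] at halg
  have hb := Algebra.IsAlgebraic.isTranscendenceBasis_of_lift_le_trdeg_of_finite A0 _
    (alg := halg) (by simpa using htr)
  have hb2 : AlgebraicIndependent A0 v :=
    AlgebraicIndependent.of_comp (IsScalarTower.toAlgHom A0 F B) hb.1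
  have e := hb2.aevalEquivField
  rw [htop] at e
  exact ⟨(e.trans IntermediateField.topEquiv).symm⟩

theorem finrank_bound {A0 A B : Type*} [Field A0] [Field A] [Field B] [Algebra A0 A]
    [Algebra A0 B] [Algebra A B] [IsScalarTower A0 A B] [FiniteDimensional A0 A]
    (F' : IntermediateField A0 B) (z : B) (p : ℕ) (hp : 2 ≤ p)
    (a b y : A) (ha : a ≠ 0) (u : B) (hu : u ∈ F')
    (hz : u = algebraMap A B a * (z ^ p - algebraMap A B y * z) + algebraMap A B b)
    (htop : ∀ D : IntermediateField A0 B, F' ≤ D → (∀ a, algebraMap A B a ∈ D) → z ∈ D → D = ⊤) :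
    FiniteDimensional F' B ∧ Module.finrank F' B ≤ Module.finrank A0 A * p := by
  let L : IntermediateField A0 B := (IsScalarTower.toAlgHom A0 A B).fieldRange
  let C : IntermediateField F' B := IntermediateField.adjoin F' (L : Set B)
  have eL : A ≃ₐ[A0] L := AlgEquiv.ofInjectiveField (IsScalarTower.toAlgHom A0 A B)
  have : FiniteDimensional A0 L := Module.Finite.equiv eL.toLinearEquiv
  have hLf : Module.finrank A0 L = Module.finrank A0 A := eL.toLinearEquiv.finrank_eq.symm
  have h1 : Module.rank F' C ≤ Module.rank A0 L :=
    IntermediateField.adjoin_rank_le_of_isAlgebraic_right F' L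
  have hC : FiniteDimensional F' C := by
    rw [FiniteDimensional, ← Module.rank_lt_aleph0_iff]
    exact h1.trans_lt (Module.rank_lt_aleph0 A0 L)
  have h2 : Module.finrank F' C ≤ Module.finrank A0 A := by
    rw [← hLf]
    have := Cardinal.toNat_le_toNat h1 (Module.rank_lt_aleph0 A0 L)
    simpa [Module.finrank] using this
  have hAC : ∀ a : A, algebraMap A B a ∈ C := fun a =>
    IntermediateField.subset_adjoin _ _ ⟨a, rfl⟩
  have hFC : ∀ a ∈ F', a ∈ C := fun a ha => C.algebraMap_mem ⟨a, ha⟩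
  have ha' : algebraMap A B a ≠ 0 := by simpa using ha
  let y' : C := ⟨algebraMap A B y, hAC y⟩
  let q' : C := ⟨(u - algebraMap A B b) / algebraMap A B a,
    C.div_mem (C.sub_mem (hFC u hu) (hAC b)) (hAC a)⟩
  let P : Polynomial C := Polynomial.X ^ p - (Polynomial.C y' * Polynomial.X + Polynomial.C q')
  have hdeg : (Polynomial.C y' * Polynomial.X + Polynomial.C q').degree < (p : WithBot ℕ) :=
    lt_of_le_of_lt Polynomial.degree_linear_le (by exact_mod_cast hp)
  have hP : P.Monic := Polynomial.monic_X_pow_sub hdeg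
  have hPd : P.natDegree = p := by
    apply Polynomial.natDegree_eq_of_degree_eq_some
    rw [Polynomial.degree_sub_eq_left_of_degree_lt, Polynomial.degree_X_pow]
    rwa [Polynomial.degree_X_pow]
  have hPz : Polynomial.aeval z P = 0 := by
    have e1 : algebraMap C B y' = algebraMap A B y := rfl
    have e2 : algebraMap C B q' = (u - algebraMap A B b) / algebraMap A B a := rfl
    simp only [P, map_sub, map_pow, map_add, map_mul, Polynomial.aeval_X, Polynomial.aeval_C, e1, e2]
    rw [hz]
    field_simp
    ring
  have hzi : IsIntegral C z := ⟨P, hP, by rwa [Polynomial.aeval_def] at hPz⟩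
  have htop' : IntermediateField.adjoin C {z} = ⊤ := by
    have := htop (((IntermediateField.adjoin C {z}).restrictScalars F').restrictScalars A0) ?_ ?_ ?_
    · rw [eq_top_iff]
      intro v _
      have hv : v ∈ (⊤ : IntermediateField A0 B) := trivial
      rw [← this] at hv
      exact hv
    · intro v hv
      exact (IntermediateField.adjoin C {z}).algebraMap_mem ⟨v, hFC v hv⟩
    · intro v
      exact (IntermediateField.adjoin C {z}).algebraMap_mem ⟨_, hAC v⟩
    · exact IntermediateField.mem_adjoin_simple_self C z
  have hCB : FiniteDimensional C B := by
    have := IntermediateField.adjoin.finiteDimensional hzi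
    rw [htop'] at this
    exact Module.Finite.equiv (IntermediateField.topEquiv (F := C) (E := B)).toLinearEquiv
  have h3 : Module.finrank C B ≤ p := by
    have h4 := IntermediateField.adjoin.finrank hzi
    rw [htop', IntermediateField.finrank_top'] at h4
    rw [h4, ← hPd]
    exact Polynomial.natDegree_le_of_dvd (minpoly.dvd C z hPz) hP.ne_zero
  refine ⟨Module.Finite.trans C B, ?_⟩
  rw [← Module.finrank_mul_finrank F' C B]
  exact Nat.mul_le_mul h2 h3

theorem core_span {K A B Gt G : Type*} [Field K] [Field A] [Field B] [Algebra K B]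
    [Algebra A B] [Group Gt] [Group G] [Fintype Gt] [Fintype G] [DecidableEq G] [DecidableEq Gt]
    [Algebra K A] [IsScalarTower K A B] (π : Gt →* G) (x : Gt → B) (X : G → A)
    (hXx : ∀ g, algebraMap A B (X g) = ∑ h with π h = g, x h)
    (f : Gt → K) (s : G → Gt) (hs : ∀ g, π (s g) = g) (hfs : ∀ g, f (s g) = 0)
    (g1 : Gt) (hg1 : f g1 ≠ 0) (E : IntermediateField A B)
    (hz : ∑ g, algebraMap K B (f g) * x g ∈ E) (g : Gt) :
    x g ∈ Submodule.span E (insert 1 (x '' 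
      ((Finset.univ \ insert g1 (Finset.univ.image s) : Finset Gt) : Set Gt))) := by
  set M := Submodule.span E (insert 1 (x '' 
      ((Finset.univ \ insert g1 (Finset.univ.image s) : Finset Gt) : Set Gt))) with hM
  have hE : ∀ e ∈ E, e ∈ M := by
    intro e he
    have : (⟨e, he⟩ : E) • (1 : B) ∈ M :=
      Submodule.smul_mem _ _ (Submodule.subset_span (Set.mem_insert _ _))
    have h2 : (⟨e, he⟩ : E) • (1 : B) = e := by
      rw [Algebra.smul_def, mul_one]; rfl
    rwa [h2] at this
  have hEm : ∀ e ∈ E, ∀ m ∈ M, e * m ∈ M := by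
    intro e he m hm
    exact Submodule.smul_mem M (⟨e, he⟩ : E) hm
  have hKE : ∀ k : K, algebraMap K B k ∈ E := fun k => by
    rw [IsScalarTower.algebraMap_apply K A B]; exact E.algebraMap_mem _
  have hT : ∀ g, g ≠ g1 → g ∉ Set.range s → x g ∈ M := by
    intro g h1 h2
    refine Submodule.subset_span (Or.inr ⟨g, ?_, rfl⟩)
    simp only [Finset.coe_sdiff, Finset.coe_univ, Finset.coe_insert, Finset.coe_image, Set.image_univ]
    simp only [Set.mem_sdiff, Set.mem_univ, true_and, Set.mem_insert_iff, not_or]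
    exact ⟨h1, h2⟩
  have hg1M : x g1 ∈ M := by
    have h1 : ∑ g, algebraMap K B (f g) * x g = algebraMap K B (f g1) * x g1 +
        ∑ g ∈ Finset.univ.erase g1, algebraMap K B (f g) * x g :=
      (Finset.add_sum_erase _ _ (Finset.mem_univ g1)).symm
    have h2 : ∑ g ∈ Finset.univ.erase g1, algebraMap K B (f g) * x g ∈ M := by
      refine Submodule.sum_mem _ fun g hg => ?_
      by_cases hgs : g ∈ Set.range s
      · obtain ⟨g', rfl⟩ := hgs
        simp [hfs]
      · exact hEm _ (hKE _) _ (hT g (Finset.ne_of_mem_erase hg) hgs)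
    have h3 : algebraMap K B (f g1) * x g1 ∈ M := by
      have := M.sub_mem (hE _ hz) h2
      rwa [h1, add_sub_cancel_right] at this
    have h4 := hEm _ (hKE (f g1)⁻¹) _ h3
    rwa [← mul_assoc, ← map_mul, inv_mul_cancel₀ hg1, map_one, one_mul] at h4
  have hns : ∀ g, g ∉ Set.range s → x g ∈ M := by
    intro g hg
    by_cases h : g = g1
    · rwa [h]
    · exact hT g h hg
  by_cases hgs : g ∈ Set.range s
  · obtain ⟨g', rfl⟩ := hgs
    have h1 : algebraMap A B (X g') ∈ M := hE _ (E.algebraMap_mem _)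
    rw [hXx, ← Finset.add_sum_erase _ _ (a := s g') (by simp [hs])] at h1
    refine (Submodule.add_mem_iff_left _ ?_).1 h1
    refine Submodule.sum_mem _ fun g hg => hns g ?_
    rintro ⟨g'', rfl⟩
    simp only [Finset.mem_erase, Finset.mem_filter, hs] at hg
    exact hg.1 (by rw [hg.2.2])
  · exact hns g hgs

theorem equivariant {K A B Gt G : Type*} [Field K] [Field A] [Field B]
    [Algebra K A] [Algebra K B] [Algebra A B] [IsScalarTower K A B]
    [Group Gt] [Group G] [Fintype Gt] [DecidableEq G]
    [MulSemiringAction Gt B] [MulSemiringAction G A] [SMulCommClass Gt K B] [SMulCommClass G K A]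
    (π : Gt →* G) (x : Gt → B) (hxact : ∀ h g, h • x g = x (h * g))
    (X : G → A) (hXtop : IntermediateField.adjoin K (Set.range X) = ⊤)
    (hXact : ∀ h g, h • X g = X (h * g))
    (hXx : ∀ g, algebraMap A B (X g) = ∑ h with π h = g, x h) (h : Gt) (a : A) :
    h • algebraMap A B a = algebraMap A B (π h • a) := by
  have ha : a ∈ IntermediateField.adjoin K (Set.range X) := by rw [hXtop]; trivial
  induction ha using IntermediateField.adjoin_induction with
  | mem y hy =>
    obtain ⟨g, rfl⟩ := hy
    rw [hXact, hXx, hXx, Finset.smul_sum]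
    simp only [hxact]
    refine Finset.sum_equiv (Equiv.mulLeft h) ?_ (fun _ _ => rfl)
    intro i
    simp
  | algebraMap k =>
    rw [← IsScalarTower.algebraMap_apply, smul_algebraMap, smul_algebraMap,
      ← IsScalarTower.algebraMap_apply]
  | add u v _ _ hu hv => simp only [map_add, smul_add, hu, hv]
  | inv u _ hu => rw [map_inv₀, smul_inv'', hu, smul_inv'', map_inv₀]
  | mul u v _ _ hu hv => simp only [map_mul, smul_mul', hu, hv]

theorem z_action {K A B Gt G : Type*} [Field K] [Field A] [Field B]
    [Algebra K A] [Algebra K B] [Algebra A B] [IsScalarTower K A B]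
    [Group Gt] [Group G] [Fintype Gt] [Fintype G] [DecidableEq G]
    [MulSemiringAction Gt B] [SMulCommClass Gt K B]
    (π : Gt →* G) (x : Gt → B) (hxact : ∀ h g, h • x g = x (h * g))
    (X : G → A) (hXx : ∀ g, algebraMap A B (X g) = ∑ h with π h = g, x h)
    (f : Gt → K) (h : Gt) (α : K) (c : G → K)
    (hf : ∀ g, f (h⁻¹ * g) = α * f g + c (π g)) :
    h • (∑ g, algebraMap K B (f g) * x g) =
      algebraMap K B α * (∑ g, algebraMap K B (f g) * x g) +
        algebraMap A B (∑ g, algebraMap K A (c g) * X g) := by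
  have h1 : h • (∑ g, algebraMap K B (f g) * x g) =
      ∑ g, algebraMap K B (f (h⁻¹ * g)) * x g := by
    simp only [Finset.smul_sum, smul_mul', smul_algebraMap, hxact]
    refine Fintype.sum_equiv (Equiv.mulLeft h) _ _ fun g => ?_
    simp
  rw [h1]
  simp only [hf, map_add, map_mul, add_mul, Finset.sum_add_distrib, Finset.mul_sum, mul_assoc,
    map_sum, ← IsScalarTower.algebraMap_apply, hXx]
  congr 1
  rw [← Finset.sum_fiberwise Finset.univ π]
  refine Finset.sum_congr rfl fun g _ => Finset.sum_congr rfl fun i hi => ?_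
  rw [(Finset.mem_filter.1 hi).2]

theorem exists_u {K A B Gt G : Type*} [Field K] [Field A] [Field B] (p : ℕ) [Fact p.Prime]
    [CharP K p]
    [Algebra K A] [Algebra K B] [Algebra A B] [IsScalarTower K A B]
    [Group Gt] [Group G] [Fintype G]
    [MulSemiringAction Gt B] [MulSemiringAction G A] [SMulCommClass Gt K B] [SMulCommClass G K A]
    [FaithfulSMul G A]
    (π : Gt →* G) (heq : ∀ (h : Gt) (a : A), h • algebraMap A B a = algebraMap A B (π h • a))
    (s : G → Gt) (hs : ∀ g, π (s g) = g)
    (z : B) (Y : A) (hY : ∀ g : G, g • Y = Y) (α : Gt → K) (hα0 : ∀ h, α h ≠ 0)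
    (hα : ∀ h, α h ^ p = α h) (C : Gt → A)
    (hz : ∀ h : Gt, h • z = algebraMap K B (α h) * z + algebraMap A B (C h))
    (hzN : ∀ h, π h = 1 → ∃ d : K, d ^ p = d ∧
      h • z = z + algebraMap K B d * algebraMap A B Y) :
    ∃ (a b : A) (u : B), a ≠ 0 ∧ (∀ h : Gt, h • u = u) ∧
      u = algebraMap A B a * (z ^ p - algebraMap A B (Y ^ (p - 1)) * z) + algebraMap A B b := by
  have : CharP B p := charP_of_injective_algebraMap (algebraMap K B).injective p
  set u0 : B := z ^ p - algebraMap A B (Y ^ (p - 1)) * z with hu0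
  have hYB : ∀ h : Gt, h • algebraMap A B Y = algebraMap A B Y := fun h => by rw [heq, hY]
  have hu : ∀ h : Gt, h • u0 = algebraMap K B (α h) * u0 +
      algebraMap A B (C h ^ p - Y ^ (p - 1) * C h) := by
    intro h
    have hαB : algebraMap K B (α h) ^ p = algebraMap K B (α h) := by rw [← map_pow, hα]
    simp only [hu0, smul_sub, smul_mul', smul_pow', map_pow, hYB, hz, add_pow_char, mul_pow, hαB,
      map_sub, map_mul]
    ring
  have hp1 : p - 1 + 1 = p := Nat.sub_add_cancel (Fact.out : p.Prime).one_le
  have huN : ∀ h, π h = 1 → h • u0 = u0 := by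
    intro h hh
    obtain ⟨d, hd, hzd⟩ := hzN h hh
    have hdB : algebraMap K B d ^ p = algebraMap K B d := by rw [← map_pow, hd]
    have hYp : algebraMap A B Y ^ p = algebraMap A B Y ^ (p - 1) * algebraMap A B Y := by
      rw [← pow_succ, hp1]
    simp only [hu0, smul_sub, smul_mul', smul_pow', map_pow, hYB, hzd, add_pow_char, mul_pow, hdB,
      hYp]
    ring
  obtain ⟨θ, hθ⟩ : ∃ θ : A, ∑ g, algebraMap K A (α (s g)) * g • θ ≠ 0 := by
    by_contra! hcon
    let σ : G → A →* A := fun g => (MulSemiringAction.toRingHom G A g : A →* A)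
    have hσ : Function.Injective σ := by
      intro g g' h
      apply FaithfulSMul.eq_of_smul_eq_smul (α := A)
      intro a
      exact DFunLike.congr_fun h a
    have := dedekind_sum σ hσ (fun g => algebraMap K A (α (s g))) hcon 1
    exact hα0 _ ((map_eq_zero _).1 this)
  refine ⟨_, ∑ g, (g • θ) * (C (s g) ^ p - Y ^ (p - 1) * C (s g)),
    ∑ g, s g • (algebraMap A B θ * u0), hθ, ?_, ?_⟩
  · intro h
    rw [Finset.smul_sum]
    refine Fintype.sum_equiv (Equiv.mulLeft (π h)) _ _ fun g => ?_
    have hn : π ((s (π h * g))⁻¹ * (h * s g)) = 1 := by simp [hs]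
    have h1 : h * s g = s (π h * g) * ((s (π h * g))⁻¹ * (h * s g)) := by group
    rw [← mul_smul, h1, mul_smul _ _ (_ : B)]
    rw [smul_mul' ((s (π h * g))⁻¹ * (h * s g)), huN _ hn, heq, hn, one_smul]
    rfl
  · simp only [smul_mul', hu, heq, hs, map_sum, map_mul, Finset.sum_mul,
      ← IsScalarTower.algebraMap_apply]
    rw [← Finset.sum_add_distrib]
    refine Finset.sum_congr rfl fun g _ => ?_
    ring

theorem core {K A0 A B F Gt G : Type*} [Field K] [Field A0] [Field A] [Field B] [Field F]
    (p : ℕ) (hp : p.Prime) [CharP K p]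
    [Algebra K A0] [Algebra K A] [Algebra K B] [Algebra A0 A] [Algebra A0 B] [Algebra A B]
    [IsScalarTower K A0 A] [IsScalarTower K A0 B] [IsScalarTower K A B] [IsScalarTower A0 A B]
    [Algebra A0 F] [Algebra F B] [IsScalarTower A0 F B]
    [Group Gt] [Group G] [Fintype Gt] [Fintype G] [DecidableEq G] [DecidableEq Gt]
    [MulSemiringAction Gt B] [MulSemiringAction G A] [SMulCommClass Gt K B] [SMulCommClass G K A]
    [IsGaloisGroup G A0 A] [IsGaloisGroup Gt F B]
    (π : Gt →* G) (hsurj : Function.Surjective π) (hker : Nat.card π.ker = p)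
    (x : Gt → B) (hx : AlgebraicIndependent K x)
    (hxtop : IntermediateField.adjoin K (Set.range x) = ⊤)
    (hxact : ∀ h g, h • x g = x (h * g))
    (X : G → A) (hX : AlgebraicIndependent K X)
    (hXtop : IntermediateField.adjoin K (Set.range X) = ⊤)
    (hXact : ∀ h g, h • X g = X (h * g))
    (hXx : ∀ g, algebraMap A B (X g) = ∑ h with π h = g, x h) :
    ∃ n : ℕ, Nonempty (F ≃ₐ[A0] FractionRing (MvPolynomial (Fin n) A0)) := by
  have : Fact p.Prime := ⟨hp⟩
  have : FiniteDimensional A0 A := IsGaloisGroup.finiteDimensional G A0 A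
  have hfA : FaithfulSMul G A := IsGaloisGroup.faithful A0
  have heq := equivariant π x hxact X hXtop hXact hXx
  obtain ⟨f, s, α, c, g1, hs, hfs, hg1, hα0, hα, hf, hfN⟩ := grp_data K p hp Gt G π hsurj hker
  set z : B := ∑ g, algebraMap K B (f g) * x g with hzdef
  set Y : A := ∑ g, X g with hYdef
  have hY : ∀ g : G, g • Y = Y := by
    intro g
    simp only [hYdef, Finset.smul_sum, hXact]
    exact Fintype.sum_equiv (Equiv.mulLeft g) _ _ (fun _ => rfl)
  have hY0 : Y ≠ 0 := by
    intro h0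
    have := Fintype.linearIndependent_iff.1 hX.linearIndependent (fun _ => 1) (by simpa using h0) 1
    exact one_ne_zero this
  have hz := fun h => z_action π x hxact X hXx f h (α h) (c h) (hf h)
  have hzN : ∀ h, π h = 1 → ∃ d : K, (d = 0 → h = 1) ∧ d ^ p = d ∧
      h • z = z + algebraMap K B d * algebraMap A B Y := by
    intro h hh
    obtain ⟨d, hd, hdp, hfd⟩ := hfN h hh
    refine ⟨d, hd, hdp, ?_⟩
    rw [z_action π x hxact X hXx f h 1 (fun _ => d) (by simpa using hfd), map_one, one_mul,
      ← Finset.mul_sum, map_mul, ← IsScalarTower.algebraMap_apply]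
  obtain ⟨a, b, u, ha, hu, hueq⟩ := exists_u p π heq s hs z Y hY α hα0 hα _ hz
    (fun h hh => by obtain ⟨d, _, h2, h3⟩ := hzN h hh; exact ⟨d, h2, h3⟩)
  set E : IntermediateField A B := IntermediateField.adjoin A {z} with hE
  have hzE : z ∈ E := IntermediateField.mem_adjoin_simple_self A z
  have hst : ∀ h : Gt, ∀ θ ∈ E, h • θ ∈ E := by
    intro h θ hθ
    induction hθ using IntermediateField.adjoin_induction with
    | mem y hy =>
      obtain rfl : y = z := hy
      rw [hz, IsScalarTower.algebraMap_apply K A B]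
      exact E.add_mem (E.mul_mem (E.algebraMap_mem _) hzE) (E.algebraMap_mem _)
    | algebraMap k => rw [heq]; exact E.algebraMap_mem _
    | add u v _ _ hu hv => rw [smul_add]; exact E.add_mem hu hv
    | inv u _ hu => rw [smul_inv'']; exact E.inv_mem hu
    | mul u v _ _ hu hv => rw [smul_mul']; exact E.mul_mem hu hv
  have hfaith : ∀ h : Gt, (∀ θ ∈ E, h • θ = θ) → h = 1 := by
    intro h hh
    have h1 : π h = 1 := by
      apply hfA.eq_of_smul_eq_smul
      intro a
      have := hh _ (E.algebraMap_mem a)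
      rw [heq] at this
      rw [one_smul]
      exact (algebraMap A B).injective this
    obtain ⟨d, hd, _, h3⟩ := hzN h h1
    rw [hh z hzE] at h3
    apply hd
    have h4 : algebraMap K B d * algebraMap A B Y = 0 := by simpa using h3
    rcases mul_eq_zero.1 h4 with h5 | h5
    · exact (map_eq_zero _).1 h5
    · exact absurd ((map_eq_zero _).1 h5) hY0
  obtain ⟨m, hm, t, htinv, ht⟩ := choose_inv E hst hfaith x hxact _
    (core_span π x X hXx f s hs hfs g1 hg1 E hzE)
  have hg1s : g1 ∉ Finset.univ.image s := by
    intro h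
    obtain ⟨g, -, rfl⟩ := Finset.mem_image.1 h
    exact hg1 (hfs g)
  have hsinj : Function.Injective s := Function.LeftInverse.injective hs
  have hcardT : m + 1 + Fintype.card G ≤ Fintype.card Gt := by
    have h1 := Finset.card_sdiff_add_card_eq_card
      (Finset.subset_univ (insert g1 (Finset.univ.image s)))
    rw [Finset.card_insert_of_notMem hg1s, Finset.card_image_of_injective _ hsinj,
      Finset.card_univ, Finset.card_univ] at h1
    omega
  have hcardG : Nat.card Gt = Nat.card G * p := by
    rw [Subgroup.card_eq_card_quotient_mul_card_subgroup π.ker, hker,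
      Nat.card_congr (QuotientGroup.quotientKerEquivOfSurjective π hsurj).toEquiv]
  have htr : ((m + 1 : ℕ) : Cardinal) ≤ Algebra.trdeg A0 B := by
    have h1 := core_trdeg (A0 := A0) x hx hxtop X hX hXtop
    have h2 : (Fintype.card G : Cardinal) + ((m + 1 : ℕ) : Cardinal) ≤
        (Fintype.card G : Cardinal) + Algebra.trdeg A0 B := by
      rw [h1]
      exact_mod_cast (by omega : Fintype.card G + (m + 1) ≤ Fintype.card Gt)
    rw [add_comm, add_comm _ (Algebra.trdeg A0 B)] at h2
    exact (Cardinal.add_le_add_iff_of_lt_aleph0 Cardinal.natCast_lt_aleph0).1 h2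
  let w : Fin (m + 1) → B := Fin.cons u t
  have hwinv : ∀ i, ∀ h : Gt, h • w i = w i := by
    intro i
    refine Fin.cases ?_ ?_ i
    · exact hu
    · exact htinv
  have hw : ∀ i, w i ∈ Set.range (algebraMap F B) := by
    intro i
    exact (IsGaloisGroup.isInvariant (G := Gt) (A := F)).isInvariant (w i) (hwinv i)
  set F' : IntermediateField A0 B := IntermediateField.adjoin A0 (Set.range w) with hF'
  have huF' : u ∈ F' := IntermediateField.subset_adjoin _ _ ⟨0, rfl⟩
  have htF' : ∀ i, t i ∈ F' := fun i => IntermediateField.subset_adjoin _ _ ⟨i.succ, by simp [w]⟩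
  obtain ⟨hfin, hrank⟩ := finrank_bound F' z p hp.two_le a b (Y ^ (p - 1)) ha u huF' hueq (by
    intro D hFD hAD hzD
    have hED : ∀ e ∈ E, e ∈ D := by
      intro e he
      induction he using IntermediateField.adjoin_induction with
      | mem y hy =>
        obtain rfl : y = z := hy
        exact hzD
      | algebraMap k => exact hAD k
      | add u v _ _ hu hv => exact D.add_mem hu hv
      | inv u _ hu => exact D.inv_mem hu
      | mul u v _ _ hu hv => exact D.mul_mem hu hv
    have hxD : ∀ g, x g ∈ D := by
      intro g
      refine Submodule.span_induction (p := fun v _ => v ∈ D) ?_ D.zero_mem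
        (fun _ _ _ _ h1 h2 => D.add_mem h1 h2) ?_ (ht g)
      · rintro v (rfl | ⟨i, rfl⟩)
        · exact D.one_mem
        · exact hFD (htF' i)
      · intro e v _ hv
        exact D.mul_mem (hED e e.2) hv
    rw [eq_top_iff]
    intro v _
    have hv : v ∈ IntermediateField.adjoin K (Set.range x) := by rw [hxtop]; trivial
    induction hv using IntermediateField.adjoin_induction with
    | mem y hy => obtain ⟨g, rfl⟩ := hy; exact hxD g
    | algebraMap k => rw [IsScalarTower.algebraMap_apply K A0 B]; exact D.algebraMap_mem _
    | add u v _ _ hu hv => exact D.add_mem (hu trivial) (hv trivial)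
    | inv u _ hu => exact D.inv_mem (hu trivial)
    | mul u v _ _ hu hv => exact D.mul_mem (hu trivial) (hv trivial))
  let FB : IntermediateField A0 B := (IsScalarTower.toAlgHom A0 F B).fieldRange
  have hle : F' ≤ FB := by
    rw [hF', IntermediateField.adjoin_le_iff]
    rintro _ ⟨i, rfl⟩
    exact hw i
  have hFBrank : Module.finrank FB B = Module.finrank F B := by
    refine (Algebra.finrank_eq_of_equiv_equiv
      (AlgEquiv.ofInjectiveField (IsScalarTower.toAlgHom A0 F B)).toRingEquiv
      (RingEquiv.refl B) ?_).symm
    ext v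
    rfl
  have hEq : F' = FB := by
    refine IntermediateField.eq_of_le_of_finrank_le' hle ?_
    rw [hFBrank, ← IsGaloisGroup.card_eq_finrank Gt F B, hcardG, IsGaloisGroup.card_eq_finrank G A0 A]
    exact hrank
  refine ⟨m + 1, core_rat w hw ?_ ?_ htr⟩
  · intro v
    rw [← hF', hEq]
    exact ⟨v, rfl⟩
  · exact Algebra.IsAlgebraic.of_finite F' B

section noetherAux

variable (K : Type*) [Field K] (G : Type*)

/-- The variable `x(g)` in the rational function field. -/
noncomputable def noetherX (g : G) : NoetherBigField K G :=
  algebraMap (MvPolynomial G K) (NoetherBigField K G) (MvPolynomial.X g)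

theorem noetherX_algInd : AlgebraicIndependent K (noetherX K G) := by
  have h := (MvPolynomial.algebraicIndependent_X G K).map'
    (f := IsScalarTower.toAlgHom K (MvPolynomial G K) (NoetherBigField K G))
    (IsFractionRing.injective (MvPolynomial G K) (NoetherBigField K G))
  exact h

theorem noetherX_top : IntermediateField.adjoin K (Set.range (noetherX K G)) = ⊤ := by
  rw [eq_top_iff]
  intro v _
  have hpoly : ∀ q : MvPolynomial G K, algebraMap (MvPolynomial G K) (NoetherBigField K G) q ∈
      IntermediateField.adjoin K (Set.range (noetherX K G)) := by
    intro q
    induction q using MvPolynomial.induction_on with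
    | C k =>
      have : algebraMap (MvPolynomial G K) (NoetherBigField K G) (MvPolynomial.C k) =
        algebraMap K (NoetherBigField K G) k := by
        rw [IsScalarTower.algebraMap_apply K (MvPolynomial G K) (NoetherBigField K G)]; rfl
      rw [this]; exact IntermediateField.algebraMap_mem _ _
    | add u v hu hv => rw [map_add]; exact IntermediateField.add_mem _ hu hv
    | mul_X u i hu =>
      rw [map_mul]
      exact IntermediateField.mul_mem _ hu (IntermediateField.subset_adjoin _ _ ⟨i, rfl⟩)
  obtain ⟨a, b, _, rfl⟩ := IsFractionRing.div_surjective (A := MvPolynomial G K) v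
  exact IntermediateField.div_mem _ (hpoly a) (hpoly b)

variable [Group G]

theorem noetherAut_X (h g : G) : noetherAut K G h (noetherX K G g) = noetherX K G (h * g) := by
  unfold noetherAut noetherX
  rw [IsFractionRing.algEquivOfAlgEquiv_algebraMap]
  simp

theorem noether_ext (u v : NoetherBigField K G →ₐ[K] NoetherBigField K G)
    (huv : ∀ g, u (noetherX K G g) = v (noetherX K G g)) (a : NoetherBigField K G) :
    u a = v a := by
  have ha : a ∈ IntermediateField.adjoin K (Set.range (noetherX K G)) := by
    rw [noetherX_top]; trivial
  induction ha using IntermediateField.adjoin_induction with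
  | mem y hy => obtain ⟨g, rfl⟩ := hy; exact huv g
  | algebraMap k => rw [u.commutes, v.commutes]
  | add a b _ _ ha hb => rw [map_add, map_add, ha, hb]
  | inv a _ ha => rw [map_inv₀, map_inv₀, ha]
  | mul a b _ _ ha hb => rw [map_mul, map_mul, ha, hb]

/-- The action of `G` on the rational function field. -/
@[reducible] noncomputable def noetherAction : MulSemiringAction G (NoetherBigField K G) where
  smul h a := noetherAut K G h a
  one_smul a := noether_ext K G (noetherAut K G 1) (AlgHom.id K _) (fun g => by
    simp [noetherAut_X]) a
  mul_smul h h' a := noether_ext K G (noetherAut K G (h * h'))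
    ((noetherAut K G h : NoetherBigField K G →ₐ[K] NoetherBigField K G).comp (noetherAut K G h'))
    (fun g => by simp [noetherAut_X, mul_assoc]) a
  smul_zero h := map_zero _
  smul_add h := map_add _
  smul_one h := map_one _
  smul_mul h := map_mul _

attribute [local instance] noetherAction

theorem noether_smul (h : G) (a : NoetherBigField K G) : h • a = noetherAut K G h a := rfl

theorem noether_smulComm : SMulCommClass G K (NoetherBigField K G) :=
  ⟨fun h k a => by rw [noether_smul, noether_smul, map_smul]⟩

/-- The inclusion of the fixed field. -/
@[reducible] noncomputable def noetherAlg : Algebra (NoetherField K G) (NoetherBigField K G) :=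
  (noetherSubfield K G).subtype.toAlgebra

attribute [local instance] noetherAlg

theorem noether_tower : IsScalarTower K (NoetherField K G) (NoetherBigField K G) :=
  IsScalarTower.of_algebraMap_eq fun _ => rfl

theorem noether_gal : IsGaloisGroup G (NoetherField K G) (NoetherBigField K G) where
  faithful := ⟨fun {h h'} hh => by
    have h1 := hh (noetherX K G 1)
    rw [noether_smul, noether_smul, noetherAut_X, noetherAut_X] at h1
    simpa using (noetherX_algInd K G).injective h1⟩
  commutes := ⟨fun h a b => by
    rw [Algebra.smul_def, Algebra.smul_def, smul_mul']
    congr 1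
    exact a.2 h⟩
  isInvariant := ⟨fun b hb => ⟨⟨b, hb⟩, rfl⟩⟩

end noetherAux

theorem fiber_algInd (K : Type*) [Field K] {Gt G : Type*} [Fintype Gt] [DecidableEq G]
    (π : Gt → G) (hsurj : Function.Surjective π) :
    Function.Injective (MvPolynomial.aeval (R := K)
      (fun g : G => ∑ h with π h = g, (MvPolynomial.X h : MvPolynomial Gt K))) := by
  classical
  choose s hs using hsurj
  let ψ : MvPolynomial Gt K →ₐ[K] MvPolynomial G K :=
    MvPolynomial.aeval fun h => if h = s (π h) then MvPolynomial.X (π h) else 0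
  have h1 : ψ.comp (MvPolynomial.aeval (R := K)
      (fun g : G => ∑ h with π h = g, (MvPolynomial.X h : MvPolynomial Gt K))) =
      AlgHom.id K _ := by
    apply MvPolynomial.algHom_ext
    intro g
    simp only [AlgHom.comp_apply, MvPolynomial.aeval_X, map_sum, ψ, AlgHom.id_apply]
    rw [Finset.sum_eq_single (s g)]
    · simp [hs]
    · intro b hb hne
      rw [(Finset.mem_filter.1 hb).2, if_neg hne]
    · intro hn; simp [hs] at hn
  intro a b hab
  have := congrArg ψ hab
  have h2 := fun a => DFunLike.congr_fun h1 a
  simp only [AlgHom.comp_apply, AlgHom.id_apply] at h2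
  rwa [h2, h2] at this

/-- The embedding on polynomials. -/
noncomputable def noetherPolyEmb (K : Type*) [Field K] {Gt G : Type*} [Fintype Gt] [DecidableEq G]
    (π : Gt → G) : MvPolynomial G K →ₐ[K] NoetherBigField K Gt :=
  (IsScalarTower.toAlgHom K (MvPolynomial Gt K) (NoetherBigField K Gt)).comp
      (MvPolynomial.aeval (R := K)
        (fun g : G => ∑ h with π h = g, (MvPolynomial.X h : MvPolynomial Gt K)))

theorem noetherPolyEmb_inj (K : Type*) [Field K] {Gt G : Type*} [Fintype Gt] [DecidableEq G]
    (π : Gt → G) (hsurj : Function.Surjective π) :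
    Function.Injective (noetherPolyEmb K π) :=
  (IsFractionRing.injective (MvPolynomial Gt K) (NoetherBigField K Gt)).comp
      (fiber_algInd K π hsurj)

/-- The embedding of big fields. -/
noncomputable def noetherBigEmb (K : Type*) [Field K] {Gt G : Type*} [Fintype Gt] [DecidableEq G]
    (π : Gt → G) (hsurj : Function.Surjective π) : NoetherBigField K G →ₐ[K] NoetherBigField K Gt :=
  IsFractionRing.liftAlgHom (noetherPolyEmb_inj K π hsurj)

theorem noetherBigEmb_X (K : Type*) [Field K] {Gt G : Type*} [Fintype Gt] [DecidableEq G]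
    (π : Gt → G) (hsurj : Function.Surjective π) (g : G) :
    noetherBigEmb K π hsurj (noetherX K G g) = ∑ h with π h = g, noetherX K Gt h := by
  have h1 : noetherBigEmb K π hsurj (noetherX K G g) =
      noetherPolyEmb K π (MvPolynomial.X g) := by
    unfold noetherBigEmb noetherX
    rw [IsFractionRing.liftAlgHom_apply, IsFractionRing.lift_algebraMap]
    rfl
  rw [h1]
  simp [noetherPolyEmb, noetherX]

/-- Theorem 1.6: if `char K = p > 0` and `1 → ℤ/pℤ → G̃ → G → 1` is a group extension of
finite groups, then there is a `K`-embedding of `K(G)` into `K(G̃)` making `K(G̃)` rational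
over (the image of) `K(G)`. -/
theorem noether_rational_central_p_extension
    (K : Type*) [Field K] (p : ℕ) (hp : p.Prime) [CharP K p]
    (Gt G : Type*) [Group Gt] [Group G] [Finite Gt] [Finite G]
    (π : Gt →* G) (hsurj : Function.Surjective π) (hker : Nat.card π.ker = p) :
    ∃ ι : NoetherField K G →ₐ[K] NoetherField K Gt,
      @IsRationalExtension (NoetherField K G) (NoetherField K Gt) _ _
        ι.toRingHom.toAlgebra := by
  classical
  have : Fintype Gt := Fintype.ofFinite Gt
  have : Fintype G := Fintype.ofFinite G
  letI := noetherAction K G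
  letI := noetherAction K Gt
  letI := noetherAlg K G
  letI := noetherAlg K Gt
  have := noether_smulComm K G
  have := noether_smulComm K Gt
  have := noether_tower K G
  have := noether_tower K Gt
  have := noether_gal K G
  have := noether_gal K Gt
  letI algAB : Algebra (NoetherBigField K G) (NoetherBigField K Gt) :=
    (noetherBigEmb K π hsurj).toRingHom.toAlgebra
  have towAB : IsScalarTower K (NoetherBigField K G) (NoetherBigField K Gt) :=
    IsScalarTower.of_algebraMap_eq fun k => ((noetherBigEmb K π hsurj).commutes k).symm
  have hXx : ∀ g, algebraMap (NoetherBigField K G) (NoetherBigField K Gt) (noetherX K G g) =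
      ∑ h with π h = g, noetherX K Gt h := noetherBigEmb_X K π hsurj
  have heq := equivariant π (noetherX K Gt) (noetherAut_X K Gt) (noetherX K G) (noetherX_top K G)
    (noetherAut_X K G) hXx
  let ι0 : NoetherField K G →+* NoetherField K Gt :=
    ((algebraMap (NoetherBigField K G) (NoetherBigField K Gt)).comp
      (algebraMap (NoetherField K G) (NoetherBigField K G))).codRestrict
      (noetherSubfield K Gt) (fun a h => by
        have h1 := heq h (algebraMap (NoetherField K G) (NoetherBigField K G) a)
        rw [RingHom.comp_apply]
        refine h1.trans (congrArg _ ?_)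
        exact a.2 (π h))
  let ι : NoetherField K G →ₐ[K] NoetherField K Gt :=
    { ι0 with
      commutes' := fun k => Subtype.ext ((noetherBigEmb K π hsurj).commutes k) }
  refine ⟨ι, ?_⟩
  letI : Algebra (NoetherField K G) (NoetherField K Gt) := ι.toRingHom.toAlgebra
  letI : Algebra (NoetherField K G) (NoetherBigField K Gt) :=
    ((algebraMap (NoetherBigField K G) (NoetherBigField K Gt)).comp
      (algebraMap (NoetherField K G) (NoetherBigField K G))).toAlgebra
  have : IsScalarTower (NoetherField K G) (NoetherBigField K G) (NoetherBigField K Gt) :=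
    IsScalarTower.of_algebraMap_eq fun _ => rfl
  have : IsScalarTower (NoetherField K G) (NoetherField K Gt) (NoetherBigField K Gt) :=
    IsScalarTower.of_algebraMap_eq fun _ => rfl
  have : IsScalarTower K (NoetherField K G) (NoetherBigField K Gt) :=
    IsScalarTower.of_algebraMap_eq fun k => ((noetherBigEmb K π hsurj).commutes k).symm
  exact core p hp π hsurj hker (noetherX K Gt) (noetherX_algInd K Gt) (noetherX_top K Gt)
    (noetherAut_X K Gt) (noetherX K G) (noetherX_algInd K G) (noetherX_top K G)
    (noetherAut_X K G) hXx

end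
end

section
/- Let K be a field with char K = p > 0, G a finite group, and H a finite p-group. Set G̃ = H × G. Then there exists a K-embedding ι : K(G) → K(G̃) such that K(G̃) is rational (purely transcendental) over the subfield ι(K(G)). -/
set_option synthInstance.maxHeartbeats 1000000
set_option maxHeartbeats 1000000

noncomputable section

open Polynomial IntermediateField in
lemma miyata_step {M Ω Γ : Type*} [Field M] [Field Ω] [Algebra M Ω] [Group Γ] [Finite Γ]
    (ρ : Γ →* (Ω ≃+* Ω)) (E : IntermediateField M Ω) (hE : ∀ σ, ∀ x ∈ E, ρ σ x ∈ E)
    (z : Ω) (hz : Transcendental E z) (hσ : ∀ σ, ρ σ z - z ∈ E) :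
    ∃ t : Ω, (∀ σ, ρ σ t = t) ∧ t ∈ E⟮z⟯ ∧ Transcendental E t ∧
      ∀ x ∈ E⟮z⟯, (∀ σ, ρ σ x = x) → ∀ S : Subfield Ω,
        (∀ y ∈ E, (∀ σ, ρ σ y = y) → y ∈ S) → t ∈ S → x ∈ S := by
  classical
  have := Fintype.ofFinite Γ
  have hinj := transcendental_iff_injective.1 hz
  have htw : ∀ σ, ∃ T : E[X] →+* E[X], (∀ f, aeval z (T f) = ρ σ (aeval z f)) ∧
      (∀ f, (T f).natDegree = f.natDegree) ∧
      (∀ f, ((T f).leadingCoeff : Ω) = ρ σ (f.leadingCoeff : Ω)) := by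
    intro σ
    let s : E →+* E := ((ρ σ : Ω →+* Ω).comp (algebraMap E Ω)).codRestrict E
      (fun x => hE σ x x.2)
    have hs : ∀ x : E, ((s x : E) : Ω) = ρ σ (x : Ω) := fun x => rfl
    let b : E := ⟨ρ σ z - z, hσ σ⟩
    refine ⟨(compRingHom (X + C b)).comp (mapRingHom s), ?_, ?_, ?_⟩
    · intro f
      induction f using Polynomial.induction_on' with
      | add p q hp hq => simp only [map_add, hp, hq]
      | monomial n a =>
        simp [← C_mul_X_pow_eq_monomial, hs, b]
    · intro f
      simp [natDegree_comp, natDegree_map]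
    · intro f
      simp only [RingHom.comp_apply, coe_mapRingHom, coe_compRingHom]
      rw [leadingCoeff_comp (by simp)]
      simp [leadingCoeff_map, hs]
  choose T hT hTd hTl using htw
  have hfix : ∀ f : E[X], (∀ σ, ρ σ (aeval z f) = aeval z f) ↔ ∀ σ, T σ f = f := by
    intro f
    refine forall_congr' fun σ => ?_
    rw [← hT, hinj.eq_iff]
  -- norms
  have hnorm : ∀ y : Ω, ∀ τ, ρ τ (∏ σ, ρ σ y) = ∏ σ, ρ σ y := by
    intro y τ
    rw [map_prod]
    refine Fintype.prod_equiv (Equiv.mulLeft τ) _ _ ?_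
    intro σ; simp
  have hex : ∃ d, ∃ f : E[X], (∀ σ, T σ f = f) ∧ 0 < d ∧ f.natDegree = d := by
    refine ⟨_, ∏ σ, T σ X, ?_, ?_, rfl⟩
    · rw [← hfix]
      intro τ
      simp only [map_prod, hT, aeval_X]
      rw [← map_prod]; exact hnorm z τ
    · rw [natDegree_prod]
      · simp [hTd, Fintype.card_pos]
      · intro σ _ h0
        have := hTd σ X
        rw [h0] at this; simp at this
  obtain ⟨f, hf, hd, hfd⟩ := Nat.find_spec hex
  have hmin := fun m hm => Nat.find_min hex (m := m) hm
  set d := Nat.find hex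
  have hf0 : f.leadingCoeff ≠ 0 := by
    rw [leadingCoeff_ne_zero]; rintro rfl; simp at hfd; omega
  have hCfix : ∀ c : E, (∀ σ, ρ σ (c : Ω) = c) → ∀ σ, T σ (C c) = C c := by
    intro c hc
    rw [← hfix]; simpa using hc
  have hlf : ∀ σ, ρ σ (f.leadingCoeff : Ω) = f.leadingCoeff := by
    intro σ; rw [← hTl, hf]
  let g : E[X] := C (f.leadingCoeff⁻¹) * f
  have hg : ∀ σ, T σ g = g := by
    intro σ
    simp only [g, map_mul, hf]
    rw [hCfix]
    intro σ
    simp [hlf]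
  have hgm : g.Monic := by
    have : f ≠ 0 := leadingCoeff_ne_zero.1 hf0
    simp only [g]; rw [mul_comm]; exact monic_mul_leadingCoeff_inv this
  have hgd : g.natDegree = d := by
    rw [← hfd]; exact natDegree_C_mul (inv_ne_zero hf0)
  have hgΩ := (hfix g).2 hg
  refine ⟨aeval z g, hgΩ, ?_, ?_, ?_⟩
  · exact algebra_adjoin_le_adjoin E {z} (aeval_mem_adjoin_singleton E z)
  · exact hz.aeval g (by omega) (by rw [hgm.leadingCoeff]; exact one_mem _)
  · intro x hx hxf S hS ht
    have key : ∀ n, ∀ q : E[X], q.natDegree ≤ n → (∀ σ, T σ q = q) → aeval z q ∈ S := by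
      have hconst : ∀ q : E[X], q.natDegree < d → (∀ σ, T σ q = q) → aeval z q ∈ S := by
        intro q hq hqf
        have h0 : q.natDegree = 0 := by
          by_contra h
          exact hmin _ hq ⟨q, hqf, Nat.pos_of_ne_zero h, rfl⟩
        rw [← hfix] at hqf
        rw [natDegree_eq_zero] at h0
        obtain ⟨c, rfl⟩ := h0
        simp only [aeval_C] at hqf ⊢
        exact hS _ c.2 hqf
      intro n
      induction n with
      | zero => intro q hq; exact hconst q (by omega)
      | succ n ih =>
        intro q hq hqf
        by_cases hqd : q.natDegree < d
        · exact hconst q hqd hqf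
        push Not at hqd
        have hu := fun σ => div_modByMonic_unique (f := q) (g := g) (T σ (q /ₘ g)) (T σ (q %ₘ g)) hgm
          ⟨by
            conv_rhs => rw [← hqf σ, ← modByMonic_add_div q g]
            simp [hg], by
            have h1 := natDegree_modByMonic_lt q hgm (by rintro h; simp [h] at hgd; omega)
            rw [← hTd σ] at h1
            exact degree_lt_degree h1⟩
        rw [← modByMonic_add_div q g, map_add, map_mul]
        refine add_mem (hconst _ ?_ fun σ => (hu σ).2.symm) (mul_mem ht (ih _ ?_ fun σ => (hu σ).1.symm))
        · rw [← hgd]; exact natDegree_modByMonic_lt q hgm (by rintro h; simp [h] at hgd; omega)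
        · rw [natDegree_divByMonic q hgm]; omega
    rw [mem_adjoin_simple_iff] at hx
    obtain ⟨r, s, rfl⟩ := hx
    by_cases hs0 : aeval z s = 0
    · simp [hs0]
    have hN : ∏ σ, ρ σ (aeval z s) ≠ 0 := by
      rw [Finset.prod_ne_zero_iff]; intro σ _
      simpa using hs0
    have e1 : ∏ σ, ρ σ (aeval z s) = aeval z (∏ σ, T σ s) := by simp [map_prod, hT]
    have e2 : (aeval z r / aeval z s) * ∏ σ, ρ σ (aeval z s)
        = aeval z (r * ∏ σ ∈ Finset.univ.erase 1, T σ s) := by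
      rw [← Finset.mul_prod_erase _ _ (Finset.mem_univ (1 : Γ))]
      simp [map_prod, hT]
      field_simp
    have h1 : ∏ σ, ρ σ (aeval z s) ∈ S := by
      rw [e1]
      refine key _ _ le_rfl ?_
      rw [← hfix, ← e1]; exact hnorm _
    have h2 : (aeval z r / aeval z s) * ∏ σ, ρ σ (aeval z s) ∈ S := by
      rw [e2]
      refine key _ _ le_rfl ?_
      rw [← hfix, ← e2]
      intro σ
      rw [map_mul, hnorm, hxf]
    have := div_mem h2 h1
    rwa [mul_div_cancel_right₀ _ hN] at this

open IntermediateField in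
lemma chain_rational {A M Ω Γ : Type*} [Field A] [Field M] [Field Ω] [Algebra A M] [Algebra A Ω]
    [Algebra M Ω] [IsScalarTower A M Ω] [Group Γ] [Finite Γ]
    (ρ : Γ →* (Ω ≃+* Ω))
    (hM : ∀ σ m, ρ σ (algebraMap M Ω m) ∈ Set.range (algebraMap M Ω))
    (hfix : ∀ m, (∀ σ, ρ σ (algebraMap M Ω m) = algebraMap M Ω m) →
      algebraMap M Ω m ∈ Set.range (algebraMap A Ω))
    (w : ℕ → Ω) (N : ℕ) (hw : AlgebraicIndependent M (fun i : Fin N => w i))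
    (tri : ∀ k < N, ∀ σ, ρ σ (w k) - w k ∈ adjoin M (w '' Set.Iio k)) :
    ∀ k ≤ N, ∃ (ι : Type) (_ : Finite ι) (θ : ι → Ω), AlgebraicIndependent A θ ∧
      (∀ i σ, ρ σ (θ i) = θ i) ∧ (∀ i, θ i ∈ adjoin M (w '' Set.Iio k)) ∧
      ∀ x ∈ adjoin M (w '' Set.Iio k), (∀ σ, ρ σ x = x) → x ∈ adjoin A (Set.range θ) := by
  have mono : ∀ j k, j ≤ k → adjoin M (w '' Set.Iio j) ≤ adjoin M (w '' Set.Iio k) :=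
    fun j k h => adjoin.mono _ _ _ (Set.image_mono (Set.Iio_subset_Iio h))
  have stab : ∀ k ≤ N, ∀ σ, ∀ x ∈ adjoin M (w '' Set.Iio k),
      ρ σ x ∈ adjoin M (w '' Set.Iio k) := by
    intro k hk σ x hx
    induction hx using IntermediateField.adjoin_induction with
    | mem x hx =>
      obtain ⟨j, hj, rfl⟩ := hx
      have h1 := mono j k (le_of_lt hj) (tri j (lt_of_lt_of_le hj hk) σ)
      have h2 : w j ∈ adjoin M (w '' Set.Iio k) := subset_adjoin _ _ ⟨j, hj, rfl⟩
      have := add_mem h1 h2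
      simpa using this
    | algebraMap m =>
      obtain ⟨m', hm'⟩ := hM σ m
      rw [← hm']; exact IntermediateField.algebraMap_mem _ _
    | add x y _ _ hx hy => rw [map_add]; exact add_mem hx hy
    | inv x _ hx => rw [map_inv₀]; exact inv_mem hx
    | mul x y _ _ hx hy => rw [map_mul]; exact mul_mem hx hy
  intro k
  induction k with
  | zero =>
    intro _
    refine ⟨Empty, inferInstance, Empty.elim, ?_, by simp, by simp, ?_⟩
    · rw [algebraicIndependent_empty_type_iff]; exact (algebraMap A Ω).injective
    · intro x hx hxf
      have : w '' Set.Iio 0 = ∅ := by simp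
      rw [this, adjoin_empty, mem_bot] at hx
      obtain ⟨m, rfl⟩ := hx
      obtain ⟨a, ha⟩ := hfix m hxf
      rw [← ha]; exact IntermediateField.algebraMap_mem _ _
  | succ k ih =>
    intro hk
    obtain ⟨ι, _, θ, hθ, hθf, hθE, hθg⟩ := ih (by omega)
    have htr : Transcendental (adjoin M (w '' Set.Iio k)) (w k) := by
      have h := hw.transcendental_adjoin (s := {i : Fin N | (i : ℕ) < k})
        (i := ⟨k, hk⟩) (by simp)
      have hs : (fun i : Fin N => w i) '' {i : Fin N | (i : ℕ) < k} = w '' Set.Iio k := by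
        ext x; constructor
        · rintro ⟨i, hi, rfl⟩; exact ⟨i, hi, rfl⟩
        · rintro ⟨i, hi, rfl⟩; exact ⟨⟨i, lt_trans hi hk⟩, hi, rfl⟩
      rw [hs] at h
      exact transcendental_adjoin_iff.2 h
    obtain ⟨t, htf, htE, htt, htg⟩ := miyata_step ρ _ (stab k (by omega)) (w k) htr
      (tri k (by omega))
    have hE' : ∀ x, x ∈ adjoin (adjoin M (w '' Set.Iio k)) {w k} ↔
        x ∈ adjoin M (w '' Set.Iio (k+1)) := by
      intro x
      have : w '' Set.Iio (k+1) = w '' Set.Iio k ∪ {w k} := by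
        rw [← Order.succ_eq_add_one, Order.Iio_succ_eq_insert, Set.image_insert_eq, Set.union_singleton]
      rw [this, ← adjoin_adjoin_left, mem_restrictScalars]
    refine ⟨Option ι, inferInstance, fun o => o.elim t θ, ?_, ?_, ?_, ?_⟩
    · rw [hθ.option_iff_transcendental]
      refine Transcendental.of_tower_top_of_subalgebra_le (B := ((adjoin M (w '' Set.Iio k)).restrictScalars A).toSubalgebra) ?_ htt
      rw [Algebra.adjoin_le_iff]
      rintro _ ⟨i, rfl⟩
      exact hθE i
    · rintro (_ | i) σ
      · exact htf σ
      · exact hθf i σ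
    · rintro (_ | i)
      · exact (hE' _).1 htE
      · exact mono k (k+1) (by omega) (hθE i)
    · intro x hx hxf
      refine htg x ((hE' x).2 hx) hxf (adjoin A _).toSubfield ?_ ?_
      · intro y hy hyf
        refine adjoin.mono A _ _ ?_ (hθg y hy hyf)
        rintro _ ⟨i, rfl⟩
        exact ⟨some i, rfl⟩
      · exact subset_adjoin A _ ⟨none, rfl⟩

lemma exists_quot_fixed {p : ℕ} [Fact p.Prime] {H V : Type*} [Group H] [AddCommGroup V]
    [Module (ZMod p) V] [Finite V] (hH : IsPGroup p H) (τ : H →* (V →ₗ[ZMod p] V))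
    (W : Submodule (ZMod p) V) (hW : ∀ h, ∀ v ∈ W, τ h v ∈ W) (hWt : W ≠ ⊤) :
    ∃ v, v ∉ W ∧ ∀ h, τ h v - v ∈ W := by
  let _ : MulAction H (V ⧸ W) :=
    { smul := fun h q => W.mapQ W (τ h) (fun v hv => hW h v hv) q
      one_smul := by
        intro q
        obtain ⟨v, rfl⟩ := Submodule.Quotient.mk_surjective W q
        change Submodule.Quotient.mk (τ 1 v) = _
        simp
      mul_smul := by
        intro a b q
        obtain ⟨v, rfl⟩ := Submodule.Quotient.mk_surjective W q
        change Submodule.Quotient.mk (τ (a * b) v) = Submodule.Quotient.mk (τ a (τ b v))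
        simp }
  have hsm : ∀ (h : H) (v : V), h • (Submodule.Quotient.mk v : V ⧸ W) =
    Submodule.Quotient.mk (τ h v) := fun _ _ => rfl
  have : Nontrivial (V ⧸ W) := Submodule.Quotient.nontrivial_iff.2 hWt
  have : Finite (V ⧸ W) := Quotient.finite _
  have hdvd : p ∣ Nat.card (V ⧸ W) := by
    rw [Module.natCard_eq_pow_finrank (K := ZMod p), Nat.card_zmod]
    exact dvd_pow_self p (Module.finrank_pos).ne'
  obtain ⟨b, hb, hb0⟩ := hH.exists_fixed_point_of_prime_dvd_card_of_fixed_point (V ⧸ W) hdvd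
    (a := 0) (by
      intro h
      have := hsm h 0
      simpa using this)
  obtain ⟨v, rfl⟩ := Submodule.Quotient.mk_surjective W b
  refine ⟨v, fun hv => hb0 ?_, fun h => ?_⟩
  · exact ((Submodule.Quotient.mk_eq_zero W).2 hv).symm
  · have := hb h
    rw [hsm] at this
    exact (Submodule.Quotient.eq W).1 this

lemma exists_flag {p : ℕ} [Fact p.Prime] {H V : Type*} [Group H] [AddCommGroup V]
    [Module (ZMod p) V] [Finite V] (hH : IsPGroup p H) (τ : H →* (V →ₗ[ZMod p] V))
    (v0 : V) (hv0 : v0 ≠ 0) (hfix : ∀ h, τ h v0 = v0) (n : ℕ)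
    (hn : n + 1 ≤ Module.finrank (ZMod p) V) :
    ∃ e : ℕ → V, (∀ i < n, ∀ h, τ h (e i) - e i ∈
        Submodule.span (ZMod p) (insert v0 (e '' Set.Iio i))) ∧
      Module.finrank (ZMod p) (Submodule.span (ZMod p) (insert v0 (e '' Set.Iio n))) = n + 1 := by
  induction n with
  | zero =>
    refine ⟨fun _ => 0, by simp, ?_⟩
    have h0 : (fun _ : ℕ => (0 : V)) '' Set.Iio 0 = ∅ := by simp
    rw [h0, insert_empty_eq, finrank_span_singleton hv0]
  | succ n ih =>
    obtain ⟨e, he, hr⟩ := ih (by omega)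
    have hstab : ∀ h, ∀ v ∈ Submodule.span (ZMod p) (insert v0 (e '' Set.Iio n)),
        τ h v ∈ Submodule.span (ZMod p) (insert v0 (e '' Set.Iio n)) := by
      intro h v hv
      have : Submodule.span (ZMod p) (insert v0 (e '' Set.Iio n)) ≤
          (Submodule.span (ZMod p) (insert v0 (e '' Set.Iio n))).comap (τ h) := by
        rw [Submodule.span_le]
        rintro x (rfl | ⟨i, hi, rfl⟩)
        · rw [SetLike.mem_coe, Submodule.mem_comap]
          rw [hfix]; exact Submodule.subset_span (Or.inl rfl)
        · rw [SetLike.mem_coe, Submodule.mem_comap]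
          have h1 := he i hi h
          have h2 := Submodule.span_mono (R := ZMod p) (Set.insert_subset_insert (a := v0)
            (Set.image_mono (f := e) (Set.Iio_subset_Iio (le_of_lt hi)))) h1
          have h3 : e i ∈ Submodule.span (ZMod p) (insert v0 (e '' Set.Iio n)) :=
            Submodule.subset_span (Or.inr ⟨i, hi, rfl⟩)
          have := add_mem h2 h3
          simpa using this
      exact this hv
    obtain ⟨v, hv, hvf⟩ := exists_quot_fixed hH τ _ hstab (by
      intro h; rw [h, finrank_top] at hr; omega)
    have himg : ∀ i ≤ n, Function.update e n v '' Set.Iio i = e '' Set.Iio i := by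
      intro i hi
      refine Set.image_congr ?_
      intro j hj
      have : j ≠ n := by simp at hj; omega
      simp [this]
    refine ⟨Function.update e n v, ?_, ?_⟩
    · intro i hi h
      rw [himg i (by omega)]
      by_cases hin : i = n
      · subst hin; simpa using hvf h
      · simpa [hin] using he i (by omega) h
    · have : Function.update e n v '' Set.Iio (n+1) = insert v (e '' Set.Iio n) := by
        rw [← Order.succ_eq_add_one, Order.Iio_succ_eq_insert, Set.image_insert_eq, himg n le_rfl]
        simp
      rw [this, Set.insert_comm, Submodule.span_insert, sup_comm,
        Submodule.finrank_sup_span_singleton hv, hr]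

lemma span_zmod_mem {p : ℕ} {V Ω : Type*} [AddCommGroup V] [Module (ZMod p) V] [Ring Ω]
    (f : V →+ Ω) (S : Subring Ω) (s : Set V) (h : ∀ v ∈ s, f v ∈ S) :
    ∀ v ∈ Submodule.span (ZMod p) s, f v ∈ S := by
  intro v hv
  have : Submodule.span (ZMod p) s ≤ AddSubgroup.toZModSubmodule p (S.toAddSubgroup.comap f) := by
    rw [Submodule.span_le]; exact h
  exact this hv

/-- The linear form attached to a vector. -/
def xform {p : ℕ} {Ω H G : Type*} [Field Ω] [CharP Ω p] [Fintype H]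
    (x : H × G → Ω) (g : G) : (H → ZMod p) →+ Ω where
  toFun v := ∑ h, ZMod.castHom (dvd_refl p) Ω (v h) * x (h, g)
  map_zero' := by simp
  map_add' := by intro a b; simp only [Pi.add_apply, map_add, add_mul, Finset.sum_add_distrib]

/-- The weighted form. -/
def zform {p : ℕ} {Ω H G : Type*} [Field Ω] [CharP Ω p] [Fintype H] [Fintype G]
    (x : H × G → Ω) (y : G → Ω) (j : ℕ) : (H → ZMod p) →+ Ω where
  toFun v := ∑ g, y g ^ j * xform x g v
  map_zero' := by simp
  map_add' := by intro a b; simp only [map_add, mul_add, Finset.sum_add_distrib]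

/-- Left translation on functions. -/
def ltrans (p : ℕ) (H : Type*) [Group H] : H →* ((H → ZMod p) →ₗ[ZMod p] (H → ZMod p)) where
  toFun h := LinearMap.funLeft (ZMod p) (ZMod p) (fun a => h⁻¹ * a)
  map_one' := by ext; simp [LinearMap.funLeft]
  map_mul' := by intro a b; apply LinearMap.ext; intro v; ext c; simp [LinearMap.funLeft, mul_assoc]

open IntermediateField in
lemma zform_tri {p : ℕ} {M Ω H G : Type*} [Field M] [Field Ω] [Algebra M Ω] [CharP Ω p]
    [Group H] [Group G] [Fintype H] [Fintype G]
    (ρ : H × G →* (Ω ≃+* Ω)) (x : H × G → Ω) (hρ : ∀ σ a, ρ σ (x a) = x (σ * a))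
    (y : G → M) (hy : ∀ g, algebraMap M Ω (y g) = ∑ h, x (h, g))
    (e : ℕ → (H → ZMod p)) (n : ℕ)
    (he : ∀ i < n, ∀ h, ltrans p H h (e i) - e i ∈
        Submodule.span (ZMod p) (insert 1 (e '' Set.Iio i)))
    (m : ℕ) (hm : m = Fintype.card G) (k : ℕ) (hk : k < n * m) (σ : H × G) :
    ρ σ (zform x (fun g => algebraMap M Ω (y g)) (k % m) (e (k / m))) -
      zform x (fun g => algebraMap M Ω (y g)) (k % m) (e (k / m)) ∈
      adjoin M ((fun k => zform x (fun g => algebraMap M Ω (y g)) (k % m) (e (k / m))) ''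
        Set.Iio k) := by
  obtain ⟨h0, g0⟩ := σ
  have hm0 : 0 < m := by rw [hm]; exact Fintype.card_pos
  have hρy : ∀ g, ρ (h0, g0) (algebraMap M Ω (y g)) = algebraMap M Ω (y (g0 * g)) := by
    intro g
    rw [hy, hy, map_sum]
    refine Fintype.sum_equiv (Equiv.mulLeft h0) _ _ ?_
    intro h; simp [hρ]
  have hρx : ∀ g v, ρ (h0, g0) (xform x g v) = xform (p := p) x (g0 * g) (ltrans p H h0 v) := by
    intro g v
    simp only [xform, AddMonoidHom.coe_mk, ZeroHom.coe_mk, map_sum, map_mul, hρ]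
    refine Fintype.sum_equiv (Equiv.mulLeft h0) _ _ ?_
    intro h
    simp [ltrans, LinearMap.funLeft]
    left
    exact RingHom.congr_fun (RingHom.ext_zmod ((ρ (h0, g0) : Ω →+* Ω).comp
      (ZMod.castHom (dvd_refl p) Ω)) (ZMod.castHom (dvd_refl p) Ω)) (v h)
  have hρz : ∀ j v, ρ (h0, g0) (zform x (fun g => algebraMap M Ω (y g)) j v) =
      zform (p := p) x (fun g => algebraMap M Ω (y g)) j (ltrans p H h0 v) := by
    intro j v
    simp only [zform, AddMonoidHom.coe_mk, ZeroHom.coe_mk, map_sum, map_mul, map_pow, hρy, hρx]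
    refine Fintype.sum_equiv (Equiv.mulLeft g0) _ _ ?_
    intro g; simp
  rw [hρz, ← map_sub]
  refine span_zmod_mem _ (adjoin M _).toSubfield.toSubring _ ?_ _
    (he (k / m) (Nat.div_lt_of_lt_mul (by rwa [mul_comm] at hk)) h0)
  rintro v (rfl | ⟨i, hi, rfl⟩)
  · have : zform (p := p) x (fun g => algebraMap M Ω (y g)) (k % m) 1 =
        algebraMap M Ω (∑ g, y g ^ (k % m + 1)) := by
      simp [zform, xform, ← hy, pow_succ]
    rw [this]
    exact IntermediateField.algebraMap_mem _ _
  · refine subset_adjoin M _ ⟨i * m + k % m, ?_, ?_⟩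
    · simp only [Set.mem_Iio] at hi ⊢
      have h1 := Nat.div_add_mod k m
      have h2 : m * (i + 1) ≤ m * (k / m) := Nat.mul_le_mul_left m hi
      rw [mul_add, mul_one] at h2
      rw [mul_comm i m]; omega
    · have h1 : (i * m + k % m) % m = k % m := by simp
      have h2 : (i * m + k % m) / m = i := by
        rw [add_comm, Nat.add_mul_div_right _ _ hm0, Nat.div_eq_of_lt (Nat.mod_lt _ hm0), zero_add]
      simp only [h1, h2]

open IntermediateField in
lemma zform_gen {p : ℕ} {M Ω H G : Type*} [Field M] [Field Ω] [Algebra M Ω] [CharP Ω p]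
    [Fintype H] [Fintype G]
    (x : H × G → Ω) (hx : adjoin M (Set.range x) = ⊤)
    (y : G → M) (hyi : Function.Injective y) (hy : ∀ g, algebraMap M Ω (y g) = ∑ h, x (h, g))
    (e : ℕ → (H → ZMod p)) (n : ℕ)
    (he : Submodule.span (ZMod p) (insert 1 (e '' Set.Iio n)) = ⊤)
    (m : ℕ) (hm : m = Fintype.card G) :
    adjoin M ((fun k => zform x (fun g => algebraMap M Ω (y g)) (k % m) (e (k / m))) ''
        Set.Iio (n * m)) = ⊤ := by
  classical
  rw [eq_top_iff, ← hx, adjoin_le_iff]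
  set E := adjoin M ((fun k => zform x (fun g => algebraMap M Ω (y g)) (k % m) (e (k / m))) ''
        Set.Iio (n * m)) with hE
  have key : ∀ i < n, ∀ g, xform x g (e i) ∈ E := by
    intro i hi g
    let P := Lagrange.basis Finset.univ y g
    have hPd : P.natDegree < m := by
      have := Lagrange.degree_basis (s := Finset.univ) (v := y) hyi.injOn (Finset.mem_univ g)
      have h2 := Polynomial.natDegree_eq_of_degree_eq_some this
      rw [h2, hm]
      have : 0 < Fintype.card G := Fintype.card_pos_iff.2 ⟨g⟩
      simp only [Finset.card_univ]; omega
    have h1 : xform x g (e i) = ∑ j ∈ Finset.range m, algebraMap M Ω (P.coeff j) *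
        zform x (fun g => algebraMap M Ω (y g)) j (e i) := by
      have : ∀ g', ∑ j ∈ Finset.range m, algebraMap M Ω (P.coeff j) * algebraMap M Ω (y g') ^ j
          = if g' = g then 1 else 0 := by
        intro g'
        have h3 : P.eval (y g') = if g' = g then 1 else 0 := by
          split_ifs with h
          · subst h
            exact Lagrange.eval_basis_self hyi.injOn (Finset.mem_univ _)
          · exact Lagrange.eval_basis_of_ne (Ne.symm h) (Finset.mem_univ _)
        rw [Polynomial.eval_eq_sum_range' hPd] at h3
        have := congrArg (algebraMap M Ω) h3
        simpa [map_sum, apply_ite] using this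
      simp only [zform, AddMonoidHom.coe_mk, ZeroHom.coe_mk, Finset.mul_sum]
      rw [Finset.sum_comm]
      simp only [← mul_assoc, ← Finset.sum_mul, this]
      simp
    rw [h1]
    refine sum_mem fun j hj => mul_mem (IntermediateField.algebraMap_mem _ _) ?_
    rw [Finset.mem_range] at hj
    refine subset_adjoin M _ ⟨i * m + j, ?_, ?_⟩
    · simp only [Set.mem_Iio]
      have : (i + 1) * m ≤ n * m := Nat.mul_le_mul_right m hi
      rw [add_mul, one_mul] at this; omega
    · have h1 : (i * m + j) % m = j := by
        rw [add_comm, Nat.add_mul_mod_self_right, Nat.mod_eq_of_lt hj]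
      have h2 : (i * m + j) / m = i := by
        rw [add_comm, Nat.add_mul_div_right _ _ (by omega), Nat.div_eq_of_lt hj, zero_add]
      simp only [h1, h2]
  rintro _ ⟨⟨h, g⟩, rfl⟩
  have h1 : x (h, g) = xform (p := p) x g (Pi.single h 1) := by
    simp [xform, Pi.single_apply, apply_ite]
  rw [h1]
  refine span_zmod_mem (xform x g) E.toSubfield.toSubring _ ?_ _
    (he ▸ Submodule.mem_top : Pi.single h (1 : ZMod p) ∈ _)
  rintro v (rfl | ⟨i, hi, rfl⟩)
  · have : xform (p := p) x g 1 = algebraMap M Ω (y g) := by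
      simp [xform, hy]
    rw [this]
    exact IntermediateField.algebraMap_mem _ _
  · exact key i hi g

open IntermediateField in
lemma rational_of_gens {A B Ω : Type*} [Field A] [Field B] [Field Ω] [Algebra A Ω]
    (iota : A →+* B) (j : B →+* Ω) (hj : ∀ a, j (iota a) = algebraMap A Ω a)
    {ι : Type} [Finite ι] (θ : ι → Ω) (hθ : AlgebraicIndependent A θ)
    (hθB : ∀ i, θ i ∈ Set.range j) (hgen : ∀ b, j b ∈ adjoin A (Set.range θ)) :
    @IsRationalExtension A B _ _ iota.toAlgebra := by
  let _ : Algebra A B := iota.toAlgebra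
  let J : B →ₐ[A] Ω := { j with commutes' := hj }
  have hJ : ∀ b, J b = j b := fun _ => rfl
  choose θ' hθ' using hθB
  let eq := (Finite.equivFin ι).symm
  let θ'' : Fin (Nat.card ι) → B := θ' ∘ eq
  have hcomp : J ∘ θ'' = θ ∘ eq := by
    ext i; exact hθ' _
  have hind : AlgebraicIndependent A θ'' := by
    refine AlgebraicIndependent.of_comp J ?_
    rw [hcomp]
    exact hθ.comp _ eq.injective
  have htop : adjoin A (Set.range θ'') = ⊤ := by
    rw [eq_top_iff]
    intro b _
    have h1 : J b ∈ (adjoin A (Set.range θ'')).map J := by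
      rw [adjoin_map, ← Set.range_comp, hcomp, Set.range_comp, eq.surjective.range_eq,
        Set.image_univ]
      exact hgen b
    obtain ⟨b', hb', h⟩ := h1
    rwa [J.toRingHom.injective h] at hb'
  exact ⟨_, ⟨((hind.aevalEquivField.trans (IntermediateField.equivOfEq htop)).trans
    IntermediateField.topEquiv).symm⟩⟩

lemma noetherAut_algebraMap (K : Type*) [Field K] (G : Type*) [Group G] (h : G)
    (q : MvPolynomial G K) :
    noetherAut K G h (algebraMap _ (NoetherBigField K G) q) =
      algebraMap _ (NoetherBigField K G) (MvPolynomial.rename (h * ·) q) := by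
  simp [noetherAut]

/-- The generators. -/
def nx (K : Type*) [Field K] (G : Type*) (g : G) : NoetherBigField K G :=
  algebraMap (MvPolynomial G K) (NoetherBigField K G) (MvPolynomial.X g)

lemma noetherAut_nx (K : Type*) [Field K] (G : Type*) [Group G] (h g : G) :
    noetherAut K G h (nx K G g) = nx K G (h * g) := by
  simp [nx, noetherAut_algebraMap]

lemma noether_hom_ext {K : Type*} [Field K] {G : Type*} {Ω : Type*} [Field Ω] [Algebra K Ω]
    (f₁ f₂ : NoetherBigField K G →ₐ[K] Ω) (h : ∀ g, f₁ (nx K G g) = f₂ (nx K G g)) : f₁ = f₂ := by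
  have : f₁.comp (IsScalarTower.toAlgHom K (MvPolynomial G K) (NoetherBigField K G)) =
    f₂.comp (IsScalarTower.toAlgHom K (MvPolynomial G K) (NoetherBigField K G)) := by
    apply MvPolynomial.algHom_ext
    intro g
    exact h g
  have h2 : (f₁ : NoetherBigField K G →+* Ω) = f₂ :=
    IsLocalization.ringHom_ext (nonZeroDivisors (MvPolynomial G K))
      (RingHom.ext fun q => DFunLike.congr_fun this q)
  exact AlgHom.ext fun x => RingHom.congr_fun h2 x

/-- The action as a homomorphism. -/
def noetherHom (K : Type*) [Field K] (G : Type*) [Group G] :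
    G →* (NoetherBigField K G ≃+* NoetherBigField K G) where
  toFun h := (noetherAut K G h : NoetherBigField K G ≃+* NoetherBigField K G)
  map_one' := by
    have := noether_hom_ext (noetherAut K G 1 : NoetherBigField K G →ₐ[K] NoetherBigField K G)
      (AlgHom.id _ _) (by intro g; simp [noetherAut_nx])
    ext x
    exact DFunLike.congr_fun this x
  map_mul' := by
    intro a b
    have := noether_hom_ext (noetherAut K G (a * b) : NoetherBigField K G →ₐ[K] NoetherBigField K G)
      ((noetherAut K G a : NoetherBigField K G →ₐ[K] NoetherBigField K G).comp
        (noetherAut K G b : NoetherBigField K G →ₐ[K] NoetherBigField K G))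
      (by intro g; simp [noetherAut_nx, mul_assoc])
    ext x
    exact DFunLike.congr_fun this x

lemma noetherHom_apply (K : Type*) [Field K] (G : Type*) [Group G] (h : G)
    (x : NoetherBigField K G) : noetherHom K G h x = noetherAut K G h x := rfl

lemma nx_adjoin (K : Type*) [Field K] (G : Type*) :
    IntermediateField.adjoin K (Set.range (nx K G)) = ⊤ := by
  rw [eq_top_iff]
  intro x _
  obtain ⟨a, b, -, rfl⟩ := IsFractionRing.div_surjective (A := MvPolynomial G K) x
  have h : ∀ q : MvPolynomial G K, algebraMap _ (NoetherBigField K G) q ∈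
      IntermediateField.adjoin K (Set.range (nx K G)) := by
    intro q
    induction q using MvPolynomial.induction_on with
    | C a =>
      rw [← MvPolynomial.algebraMap_eq, ← IsScalarTower.algebraMap_apply]
      exact IntermediateField.algebraMap_mem _ _
    | add p q hp hq => rw [map_add]; exact add_mem hp hq
    | mul_X p i hp =>
      rw [map_mul]; exact mul_mem hp (IntermediateField.subset_adjoin _ _ ⟨i, rfl⟩)
  exact div_mem (h a) (h b)

lemma nx_algInd (K : Type*) [Field K] (G : Type*) : AlgebraicIndependent K (nx K G) := by
  have := (MvPolynomial.algebraicIndependent_X G K).map' 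
    (f := IsScalarTower.toAlgHom K (MvPolynomial G K) (NoetherBigField K G))
    (IsFractionRing.injective _ _)
  exact this

lemma nx_basis (K : Type*) [Field K] (G : Type*) : IsTranscendenceBasis K (nx K G) := by
  rw [isTranscendenceBasis_iff_algebraicIndependent_isAlgebraic]
  refine ⟨nx_algInd K G, ?_⟩
  rw [← IntermediateField.isAlgebraic_adjoin_iff_top, nx_adjoin]
  refine ⟨fun x => ?_⟩
  exact isAlgebraic_algebraMap (⟨x, trivial⟩ : (⊤ : IntermediateField K (NoetherBigField K G)))

/-- Fiber sums. -/
def ny (K : Type*) [Field K] (H G : Type*) [Fintype H] (g : G) : NoetherBigField K (H × G) :=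
  ∑ h, nx K (H × G) (h, g)

lemma ny_algInd (K : Type*) [Field K] (H G : Type*) [Group H] [Fintype H] :
    AlgebraicIndependent K (ny K H G) := by
  classical
  have h1 : AlgebraicIndependent K
      (fun g : G => (∑ h : H, MvPolynomial.X (h, g) : MvPolynomial (H × G) K)) := by
    refine AlgebraicIndependent.of_comp (MvPolynomial.aeval
      (fun a : H × G => if a.1 = 1 then (MvPolynomial.X a.2 : MvPolynomial G K) else 0)) ?_
    convert MvPolynomial.algebraicIndependent_X G K using 1
    ext1 g
    simp
  have := h1.map' (f := IsScalarTower.toAlgHom K (MvPolynomial (H × G) K)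
    (NoetherBigField K (H × G))) (IsFractionRing.injective _ _)
  convert this using 1
  ext1 g
  simp [ny, nx]

/-- The embedding of big fields. -/
def nphi (K : Type*) [Field K] (H G : Type*) [Group H] [Fintype H] :
    NoetherBigField K G →ₐ[K] NoetherBigField K (H × G) :=
  IsFractionRing.liftAlgHom (algebraicIndependent_iff_injective_aeval.2 (ny_algInd K H G))

lemma nphi_nx (K : Type*) [Field K] (H G : Type*) [Group H] [Fintype H] (g : G) :
    nphi K H G (nx K G g) = ny K H G g := by
  have h := IsFractionRing.lift_algebraMap (K := NoetherBigField K G)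
    (algebraicIndependent_iff_injective_aeval.2 (ny_algInd K H G)) (MvPolynomial.X g)
  refine Eq.trans h ?_
  simp

lemma nphi_equiv (K : Type*) [Field K] (H G : Type*) [Group H] [Fintype H] [Group G]
    (h : H) (g : G) (x : NoetherBigField K G) :
    noetherAut K (H × G) (h, g) (nphi K H G x) = nphi K H G (noetherAut K G g x) := by
  have := noether_hom_ext
    ((noetherAut K (H × G) (h, g) : NoetherBigField K (H × G) →ₐ[K] _).comp (nphi K H G))
    ((nphi K H G).comp (noetherAut K G g : NoetherBigField K G →ₐ[K] _)) (by
      intro g'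
      simp only [AlgHom.comp_apply, AlgEquiv.coe_toAlgHom, nphi_nx, noetherAut_nx, ny, map_sum]
      refine Fintype.sum_equiv (Equiv.mulLeft h) _ _ ?_
      intro a; simp)
  exact DFunLike.congr_fun this x

/-- The embedding of fixed fields. -/
def niota (K : Type*) [Field K] (H G : Type*) [Group H] [Fintype H] [Group G] :
    NoetherField K G →ₐ[K] NoetherField K (H × G) :=
  { ((nphi K H G : _ →+* _).comp (noetherSubfield K G).subtype).codRestrict
      (noetherSubfield K (H × G)).toSubring (by
        rintro ⟨x, hx⟩ ⟨h, g⟩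
        change noetherAut K (H × G) (h, g) (nphi K H G x) = nphi K H G x
        rw [nphi_equiv, hx g]) with
    commutes' := by
      intro c
      apply Subtype.ext
      exact (nphi K H G).commutes c }

theorem noether_rational_over_direct_factor_p_group
    (K : Type*) [Field K] (p : ℕ) (hp : p.Prime) [CharP K p]
    (G : Type*) [Group G] [Finite G]
    (H : Type*) [Group H] [Finite H] (hH : IsPGroup p H) :
    ∃ ι : NoetherField K G →ₐ[K] NoetherField K (H × G),
      @IsRationalExtension (NoetherField K G) (NoetherField K (H × G)) _ _
        ι.toRingHom.toAlgebra := by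
  have : Fact p.Prime := ⟨hp⟩
  have := Fintype.ofFinite G
  have := Fintype.ofFinite H
  refine ⟨niota K H G, ?_⟩
  have hchar : CharP (NoetherBigField K (H × G)) p :=
    charP_of_injective_algebraMap (algebraMap K (NoetherBigField K (H × G))).injective p
  let _ : Algebra (NoetherField K G) (NoetherBigField K G) :=
    RingHom.toAlgebra (noetherSubfield K G).subtype
  let _ : Algebra (NoetherBigField K G) (NoetherBigField K (H × G)) :=
    RingHom.toAlgebra (nphi K H G : NoetherBigField K G →+* NoetherBigField K (H × G))
  let _ : Algebra (NoetherField K G) (NoetherBigField K (H × G)) :=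
    RingHom.toAlgebra ((nphi K H G : NoetherBigField K G →+* NoetherBigField K (H × G)).comp
      (noetherSubfield K G).subtype)
  have t1 : IsScalarTower (NoetherField K G) (NoetherBigField K G) (NoetherBigField K (H × G)) :=
    IsScalarTower.of_algebraMap_eq fun _ => rfl
  have t2 : IsScalarTower K (NoetherBigField K G) (NoetherBigField K (H × G)) :=
    IsScalarTower.of_algebraMap_eq fun c => ((nphi K H G).commutes c).symm
  have hmap : ∀ m, algebraMap (NoetherBigField K G) (NoetherBigField K (H × G)) m = nphi K H G m :=
    fun _ => rfl
  obtain ⟨n, hn⟩ : ∃ n, Fintype.card H = n + 1 :=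
    ⟨Fintype.card H - 1, by have : 0 < Fintype.card H := Fintype.card_pos
                            omega⟩
  have hfr : Module.finrank (ZMod p) (H → ZMod p) = n + 1 := by simp [hn]
  obtain ⟨e, he, hr⟩ := exists_flag hH (ltrans p H) 1 one_ne_zero
    (by intro h; ext; simp [ltrans, LinearMap.funLeft]) n hfr.ge
  have hspan := Submodule.eq_top_of_finrank_eq (hr.trans hfr.symm)
  have hy : ∀ g, algebraMap (NoetherBigField K G) (NoetherBigField K (H × G)) (nx K G g) =
      ∑ h, nx K (H × G) (h, g) := by
    intro g; rw [hmap, nphi_nx]; rfl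
  have hx : IntermediateField.adjoin (NoetherBigField K G) (Set.range (nx K (H × G))) = ⊤ := by
    rw [eq_top_iff]
    intro x _
    have h1 : x ∈ IntermediateField.adjoin K (Set.range (nx K (H × G))) := by
      rw [nx_adjoin]; trivial
    have h2 : IntermediateField.adjoin K (Set.range (nx K (H × G))) ≤
      (IntermediateField.adjoin (NoetherBigField K G)
        (Set.range (nx K (H × G)))).restrictScalars K := by
      rw [IntermediateField.adjoin_le_iff]
      exact IntermediateField.subset_adjoin _ _
    exact h2 h1
  have htri := fun k hk σ => zform_tri (noetherHom K (H × G)) (nx K (H × G))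
    (fun σ a => noetherAut_nx K (H × G) σ a) (nx K G) hy e n he (Fintype.card G) rfl k hk σ
  have hgen := zform_gen (nx K (H × G)) hx (nx K G) (nx_algInd K G).injective hy e n hspan
    (Fintype.card G) rfl
  set w : ℕ → NoetherBigField K (H × G) := fun k => zform (nx K (H × G))
    (fun g => algebraMap (NoetherBigField K G) (NoetherBigField K (H × G)) (nx K G g))
    (k % Fintype.card G) (e (k / Fintype.card G)) with hw
  have hwind : AlgebraicIndependent (NoetherBigField K G)
      (fun i : Fin (n * Fintype.card G) => w i) := by
    have hrange : Set.range (fun i : Fin (n * Fintype.card G) => w i) =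
        w '' Set.Iio (n * Fintype.card G) := by
      ext x; constructor
      · rintro ⟨i, rfl⟩; exact ⟨i, i.2, rfl⟩
      · rintro ⟨i, hi, rfl⟩; exact ⟨⟨i, hi⟩, rfl⟩
    have halg : Algebra.IsAlgebraic (Algebra.adjoin (NoetherBigField K G)
        (Set.range (fun i : Fin (n * Fintype.card G) => w i))) (NoetherBigField K (H × G)) := by
      rw [← IntermediateField.isAlgebraic_adjoin_iff_top, hrange, hgen]
      refine ⟨fun x => ?_⟩
      exact isAlgebraic_algebraMap
        (⟨x, trivial⟩ : (⊤ : IntermediateField (NoetherBigField K G) (NoetherBigField K (H × G))))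
    have b1 := (nx_basis K G).lift_cardinalMk_eq_trdeg
    have b2 := (nx_basis K (H × G)).lift_cardinalMk_eq_trdeg
    have b3 := lift_trdeg_add_eq K (NoetherBigField K G) (NoetherBigField K (H × G))
    refine (Algebra.IsAlgebraic.isTranscendenceBasis_of_lift_le_trdeg_of_finite
      (NoetherBigField K G) _ ?_).1
    have b1' : Algebra.trdeg K (NoetherBigField K G) = (Fintype.card G : ℕ) := by
      simpa using b1.symm
    have b2' : Algebra.trdeg K (NoetherBigField K (H × G)) =
        (((n + 1) * Fintype.card G : ℕ) : Cardinal) := by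
      rw [Cardinal.mk_fintype, Cardinal.lift_natCast, Fintype.card_prod, hn] at b2
      refine Cardinal.lift_injective ?_
      rw [Cardinal.lift_natCast]
      exact b2.symm
    rw [b1', b2', Cardinal.lift_natCast, Cardinal.lift_natCast] at b3
    have hlt : Algebra.trdeg (NoetherBigField K G) (NoetherBigField K (H × G)) <
        Cardinal.aleph0 := by
      rw [← Cardinal.lift_lt_aleph0]
      refine lt_of_le_of_lt (le_add_self.trans b3.le) (Cardinal.natCast_lt_aleph0)
    obtain ⟨c, hc⟩ := Cardinal.lt_aleph0.1 hlt
    rw [hc] at b3 ⊢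
    rw [Cardinal.lift_natCast] at b3
    have b4 : Fintype.card G + c = (n + 1) * Fintype.card G := by exact_mod_cast b3
    rw [Cardinal.mk_fin, Cardinal.lift_natCast, Cardinal.lift_natCast]
    have : n * Fintype.card G ≤ c := by
      rw [add_mul, one_mul] at b4; omega
    exact_mod_cast this
  obtain ⟨ι, _, θ, hθ, hθf, -, hθg⟩ := chain_rational (A := NoetherField K G)
    (noetherHom K (H × G))
    (by
      rintro ⟨h, g⟩ m
      exact ⟨noetherAut K G g m, (nphi_equiv K H G h g m).symm⟩)
    (by
      intro m hm
      refine ⟨⟨m, fun g => ?_⟩, rfl⟩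
      have := hm (1, g)
      rw [noetherHom_apply, hmap, nphi_equiv] at this
      exact (nphi K H G).toRingHom.injective this) w _ hwind htri _ le_rfl
  refine rational_of_gens (niota K H G).toRingHom (noetherSubfield K (H × G)).subtype
    (fun a => rfl) θ hθ ?_ ?_
  · intro i
    exact ⟨⟨θ i, fun σ => hθf i σ⟩, rfl⟩
  · intro b
    refine hθg _ ?_ ?_
    · rw [hgen]; trivial
    · exact fun σ => b.2 σ

end
end

section
/- (Kuniyoshi's Theorem) Let K be a field with char K = p > 0 and let G be a finite p-group. Then K(G) is rational (purely transcendental) over K. -/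
set_option synthInstance.maxHeartbeats 1000000
set_option maxHeartbeats 1000000

noncomputable section

theorem kun_fixed_vector {K G U : Type*} [Field K] (p : ℕ) (hp : p.Prime) [CharP K p]
    [Group G] [Finite G] (hG : IsPGroup p G) [AddCommGroup U] [Module K U]
    (r : Representation K G U) (u : U) (hu : u ≠ 0) :
    ∃ v : U, v ≠ 0 ∧ ∀ g, r g v = v := by
  have := Fact.mk hp
  let S : AddSubgroup U := AddSubgroup.closure (Set.range fun g => r g u)
  have hS : ∀ g, ∀ x ∈ S, r g x ∈ S := by
    intro g x hx
    induction hx using AddSubgroup.closure_induction with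
    | mem x hx =>
      obtain ⟨h, rfl⟩ := hx
      refine AddSubgroup.subset_closure ⟨g * h, ?_⟩
      simp
    | zero => simp [S.zero_mem]
    | add x y _ _ h1 h2 => rw [map_add]; exact S.add_mem h1 h2
    | neg x _ h1 => rw [map_neg]; exact S.neg_mem h1
  have hpU : ∀ x : U, p • x = 0 := by
    intro x
    rw [← Nat.cast_smul_eq_nsmul K, CharP.cast_eq_zero, zero_smul]
  have fin : Finite S := by
    have : AddGroup.FG S := (AddGroup.fg_iff_addSubgroup_fg S).2
      ((AddSubgroup.fg_iff S).2 ⟨_, rfl, Set.finite_range _⟩)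
    have : Module.Finite ℤ S := Module.Finite.iff_addGroup_fg.2 inferInstance
    apply Module.finite_of_fg_torsion
    intro x
    refine ⟨⟨(p : ℤ), mem_nonZeroDivisors_of_ne_zero (by exact_mod_cast hp.ne_zero)⟩, ?_⟩
    apply Subtype.ext
    simpa using hpU x
  let : MulAction G S :=
    { smul := fun g x => ⟨r g x, hS g x x.2⟩
      one_smul := fun x => Subtype.ext (by change r 1 (x:U) = x; simp)
      mul_smul := fun g h x => Subtype.ext (by change r (g * h) (x:U) = r g (r h x); simp) }
  have huS : u ∈ S := AddSubgroup.subset_closure ⟨1, by simp⟩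
  have hdvd : p ∣ Nat.card S := by
    have h1 : addOrderOf (⟨u, huS⟩ : S) = p :=
      addOrderOf_eq_prime (Subtype.ext (hpU u)) (fun h => hu (congrArg Subtype.val h))
    rw [← h1]; exact addOrderOf_dvd_natCard _
  obtain ⟨b, hb, hb0⟩ := hG.exists_fixed_point_of_prime_dvd_card_of_fixed_point S hdvd
    (a := 0) (fun g => Subtype.ext (by change r g 0 = 0; simp))
  exact ⟨b, fun h => hb0 (Subtype.ext h.symm), fun g => congrArg Subtype.val (hb g)⟩

theorem kun_next {K G V : Type*} [Field K] (p : ℕ) (hp : p.Prime) [CharP K p]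
    [Group G] [Finite G] (hG : IsPGroup p G) [AddCommGroup V] [Module K V]
    (r : Representation K G V) (W : Submodule K V) (hW : ∀ g, W ≤ W.comap (r g))
    (hne : W ≠ ⊤) : ∃ v : V, v ∉ W ∧ ∀ g, r g v - v ∈ W := by
  obtain ⟨u, -, hu⟩ := SetLike.exists_of_lt (lt_top_iff_ne_top.2 hne)
  obtain ⟨v, hv, h⟩ := kun_fixed_vector p hp hG (r.quotient W hW) (W.mkQ u) (by simpa using hu)
  obtain ⟨v, rfl⟩ := W.mkQ_surjective v
  refine ⟨v, by simpa using hv, fun g => ?_⟩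
  have := h g
  rw [← Submodule.Quotient.eq]
  simpa using this

open Polynomial in
theorem kun_miyata {K M Γ : Type*} [Field K] [Field M] [Algebra K M] [Group Γ] [Finite Γ]
    (ρ : Γ →* (M ≃ₐ[K] M)) (L : IntermediateField K M) (hL : ∀ g, ∀ a ∈ L, ρ g a ∈ L)
    (x : M) (hx : Transcendental L x) (hgx : ∀ g, ρ g x - x ∈ L) :
    ∃ f : M, Transcendental L f ∧ (∀ g, ρ g f = f) ∧
      f ∈ IntermediateField.adjoin L {x} ∧
      ∀ u ∈ IntermediateField.adjoin L {x}, (∀ g, ρ g u = u) →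
        u ∈ IntermediateField.adjoin K ({a | a ∈ L ∧ ∀ g, ρ g a = a} ∪ {f}) := by
  classical
  have := Fintype.ofFinite Γ
  have inj : Function.Injective (aeval x : L[X] → M) := by
    exact transcendental_iff_injective.1 hx
  have tr : ∀ g (P : L[X]), ∃ Q : L[X], Q.degree = P.degree ∧ aeval x Q = ρ g (aeval x P) := by
    intro g P
    let σ : L →+* L := ((ρ g : M →+* M).comp (algebraMap L M)).codRestrict L
      (fun a => hL g a a.2)
    have hσ : ∀ a : L, algebraMap L M (σ a) = ρ g a := fun a => rfl
    refine ⟨(P.map σ).comp (X + C ⟨_, hgx g⟩), ?_, ?_⟩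
    · by_cases hP : P = 0
      · simp [hP]
      have h2 : ((P.map σ).comp (X + C (⟨_, hgx g⟩ : L))) ≠ 0 := by
        intro h
        rw [← taylor_apply] at h
        exact hP ((Polynomial.map_eq_zero σ).1 (taylor_injective _ (h.trans (map_zero _).symm)))
      rw [degree_eq_natDegree h2, degree_eq_natDegree hP, natDegree_comp]
      simp
    · rw [aeval_comp]
      have : aeval x (X + C (⟨_, hgx g⟩ : L)) = ρ g x := by
        simp [IntermediateField.algebraMap_apply]
      rw [this, aeval_def, aeval_def, eval₂_map, ← AlgEquiv.coe_ringEquiv, ← RingEquiv.coe_toRingHom, hom_eval₂]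
      rfl
  have hS : ∃ n, ∃ P : L[X], (∀ g, ρ g (aeval x P) = aeval x P) ∧ 0 < P.natDegree ∧
      P.natDegree = n := by
    refine ⟨_, ∏ g : Γ, (X + C (⟨_, hgx g⟩ : L)), ?_, ?_, rfl⟩
    · have : aeval x (∏ g : Γ, (X + C (⟨_, hgx g⟩ : L))) = ∏ g : Γ, ρ g x := by
        rw [map_prod]
        refine Finset.prod_congr rfl fun g _ => ?_
        simp [IntermediateField.algebraMap_apply]
      intro h
      rw [this, map_prod]
      refine Fintype.prod_equiv (Equiv.mulLeft h) _ _ fun g => ?_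
      simp
    · rw [natDegree_prod_of_monic _ _ (fun g _ => monic_X_add_C _)]
      simp [Fintype.card_pos]
  obtain ⟨f, hf, hfpos, hfn⟩ := Nat.find_spec hS
  have hmin : ∀ P : L[X], (∀ g, ρ g (aeval x P) = aeval x P) → P.natDegree < f.natDegree →
      P.natDegree = 0 := by
    intro P hP hlt
    by_contra h0
    rw [hfn] at hlt
    exact Nat.find_min hS hlt ⟨P, hP, Nat.pos_of_ne_zero h0, rfl⟩
  have hf0 : f ≠ 0 := by rintro rfl; simp at hfpos
  refine ⟨aeval x f, hx.aeval f hfpos.ne' (mem_nonZeroDivisors_of_ne_zero (by simpa using hf0)),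
    hf, (IntermediateField.mem_adjoin_simple_iff _ _).2 ⟨f, 1, by simp⟩, ?_⟩
  set E := IntermediateField.adjoin K ({a | a ∈ L ∧ ∀ g, ρ g a = a} ∪ {aeval x f}) with hE
  have hfE : aeval x f ∈ E := IntermediateField.subset_adjoin _ _ (Or.inr rfl)
  have hconst : ∀ P : L[X], (∀ g, ρ g (aeval x P) = aeval x P) → P.natDegree = 0 →
      aeval x P ∈ E := by
    intro P hP h0
    refine IntermediateField.subset_adjoin _ _ (Or.inl ⟨?_, hP⟩)
    rw [natDegree_eq_zero] at h0
    obtain ⟨c, rfl⟩ := h0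
    simp [IntermediateField.algebraMap_apply]
  have claim : ∀ n, ∀ P : L[X], P.natDegree = n → (∀ g, ρ g (aeval x P) = aeval x P) →
      aeval x P ∈ E := by
    intro n
    induction n using Nat.strong_induction_on with
    | _ n ih =>
    intro P hn hP
    rcases Nat.eq_zero_or_pos P.natDegree with h0 | hpos
    · exact hconst P hP h0
    have key : ∀ g, ρ g (aeval x (P % f)) = aeval x (P % f) ∧
        ρ g (aeval x (P / f)) = aeval x (P / f) := by
      intro g
      obtain ⟨q, hq, hq'⟩ := tr g (P / f)
      obtain ⟨s, hs, hs'⟩ := tr g (P % f)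
      have e1 : P = f * q + s := by
        apply inj
        rw [map_add, map_mul, hq', hs', ← hf g, ← map_mul, ← map_add, ← map_mul, ← map_add,
          EuclideanDomain.div_add_mod, hP g]
      have hsd : s.degree < f.degree := by rw [hs]; exact degree_mod_lt _ hf0
      have e2 : P % f = s := by
        conv_lhs => rw [e1]
        rw [add_mod, (mod_eq_self_iff hf0).2 hsd]
        simp
      have e3 : P / f = q := by
        have h3 := EuclideanDomain.div_add_mod P f
        rw [e2] at h3
        have h4 : f * (P / f) = f * q := by
          have := h3.trans e1
          exact add_right_cancel this
        exact mul_left_cancel₀ hf0 h4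
      rw [← hs', ← hq', e2, e3]; exact ⟨rfl, rfl⟩
    rw [← EuclideanDomain.div_add_mod P f, map_add, map_mul]
    refine E.add_mem (E.mul_mem hfE ?_) ?_
    · refine ih (P / f).natDegree ?_ _ rfl (fun g => (key g).2)
      rcases eq_or_ne (P / f) 0 with hz | hz
      · rw [hz, natDegree_zero]; omega
      · rw [← hn]
        refine natDegree_lt_natDegree hz (degree_div_lt ?_ (natDegree_pos_iff_degree_pos.1 hfpos))
        rintro rfl; simp at hpos
    · refine hconst _ (fun g => (key g).1) (hmin _ (fun g => (key g).1) ?_)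
      exact natDegree_mod_lt _ hfpos.ne'
  intro u hu hfix
  obtain ⟨P, Q, rfl⟩ := (IntermediateField.mem_adjoin_simple_iff _ _).1 hu
  by_cases hQ : Q = 0
  · simp [hQ]
  have hQx : aeval x Q ≠ 0 := fun h => hQ (inj (h.trans (map_zero _).symm))
  choose T hT hT' using fun g => tr g Q
  have hN : aeval x (∏ g, T g) = ∏ g, ρ g (aeval x Q) := by
    rw [map_prod]; exact Finset.prod_congr rfl fun g _ => hT' g
  have hN0 : aeval x (∏ g, T g) ≠ 0 := by
    rw [hN]; exact Finset.prod_ne_zero_iff.2 fun g _ => by simpa using hQx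
  have hNfix : ∀ g, ρ g (aeval x (∏ g, T g)) = aeval x (∏ g, T g) := by
    intro h
    rw [hN, map_prod]
    refine Fintype.prod_equiv (Equiv.mulLeft h) _ _ fun g => ?_
    simp
  have hT1 : aeval x (T 1) = aeval x Q := by rw [hT']; simp
  have e : aeval x P / aeval x Q * aeval x (∏ g, T g) =
      aeval x (P * ∏ g ∈ Finset.univ.erase 1, T g) := by
    rw [← Finset.mul_prod_erase _ _ (Finset.mem_univ (1 : Γ)), map_mul, map_mul, hT1]
    field_simp
  have h1 := claim _ _ rfl hNfix
  have h2 := claim _ (P * ∏ g ∈ Finset.univ.erase 1, T g) rfl (fun g => by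
    rw [← e, map_mul, hfix, hNfix])
  rw [← e] at h2
  have := E.div_mem h2 h1
  rwa [mul_div_cancel_right₀ _ hN0] at this

def kunLin (K : Type*) [Field K] (G : Type*) : (G →₀ K) →ₗ[K] NoetherBigField K G :=
  Finsupp.linearCombination K
    (fun g => algebraMap (MvPolynomial G K) (NoetherBigField K G) (MvPolynomial.X g))

theorem kun_basis {K : Type*} [Field K] {G κ : Type*} (b : Module.Basis κ K (G →₀ K)) :
    AlgebraicIndependent K (fun i => kunLin K G (b i)) := by
  let e : MvPolynomial κ K ≃ₐ[K] MvPolynomial G K :=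
    (SymmetricAlgebra.equivMvPolynomial b).symm.trans
      (SymmetricAlgebra.equivMvPolynomial Finsupp.basisSingleOne)
  let i : MvPolynomial G K →ₐ[K] NoetherBigField K G :=
    IsScalarTower.toAlgHom K (MvPolynomial G K) (NoetherBigField K G)
  have h1 : kunLin K G = i.toLinearMap ∘ₗ
      (SymmetricAlgebra.equivMvPolynomial Finsupp.basisSingleOne).toLinearMap ∘ₗ
        SymmetricAlgebra.ι K (G →₀ K) := by
    refine Finsupp.basisSingleOne.ext fun g => ?_
    have := SymmetricAlgebra.equivMvPolynomial_ι_apply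
      (Finsupp.basisSingleOne : Module.Basis G K (G →₀ K)) g
    simp only [LinearMap.comp_apply, AlgEquiv.toLinearMap_apply, AlgHom.toLinearMap_apply]
    rw [this]
    simp [kunLin, i]
  have h2 : MvPolynomial.aeval (fun k => kunLin K G (b k)) = i.comp e.toAlgHom := by
    refine MvPolynomial.algHom_ext fun k => ?_
    rw [MvPolynomial.aeval_X, h1]
    simp [e]
  rw [algebraicIndependent_iff_injective_aeval, h2]
  exact (IsFractionRing.injective (MvPolynomial G K) (NoetherBigField K G)).comp e.injective

theorem kun_trans {K : Type*} [Field K] {G : Type*} (W : Submodule K (G →₀ K)) (v : G →₀ K)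
    (hv : v ∉ W) :
    Transcendental (IntermediateField.adjoin K (kunLin K G '' (W : Set (G →₀ K))))
      (kunLin K G v) := by
  obtain ⟨s, hsW, hspan, hs⟩ := exists_linearIndependent K (W : Set (G →₀ K))
  have hspan' : Submodule.span K s = W := by rw [hspan, Submodule.span_eq]
  have hs' : LinearIndepOn K id (insert v s) :=
    LinearIndepOn.id_insert hs (by rwa [hspan'])
  have hE : IntermediateField.adjoin K (kunLin K G '' (W : Set (G →₀ K))) =
      IntermediateField.adjoin K (kunLin K G '' s) := by
    apply le_antisymm
    · rw [IntermediateField.adjoin_le_iff]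
      rintro _ ⟨w, hw, rfl⟩
      have hw' : w ∈ Submodule.span K s := by rw [hspan']; exact hw
      clear hw
      induction hw' using Submodule.span_induction with
      | mem x hx => exact IntermediateField.subset_adjoin _ _ ⟨x, hx, rfl⟩
      | zero => rw [map_zero]; exact zero_mem _
      | add x y _ _ h1 h2 => rw [map_add]; exact add_mem h1 h2
      | smul a x _ h => rw [map_smul]; exact IntermediateField.smul_mem _ h
    · exact IntermediateField.adjoin.mono _ _ _ (Set.image_mono hsW)
  rw [hE, IntermediateField.transcendental_adjoin_iff]
  have hb := kun_basis (Module.Basis.extend hs')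
  have hsub : insert v s ⊆ hs'.extend (Set.subset_univ _) := hs'.subset_extend _
  have := hb.transcendental_adjoin (s := Subtype.val ⁻¹' s)
    (i := ⟨v, hsub (Set.mem_insert _ _)⟩) (fun h => hv (hsW h))
  have himg : (fun i => kunLin K G (Module.Basis.extend hs' i)) '' (Subtype.val ⁻¹' s) =
      kunLin K G '' s := by
    ext y
    constructor
    · rintro ⟨i, hi, rfl⟩
      exact ⟨i, hi, by simp⟩
    · rintro ⟨w, hw, rfl⟩
      exact ⟨⟨w, hsub (Set.mem_insert_of_mem _ hw)⟩, hw, by simp⟩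
  rw [himg] at this
  simpa using this

def kunRep (K : Type*) [Field K] (G : Type*) [Group G] : Representation K G (G →₀ K) where
  toFun h := Finsupp.lmapDomain K K (h * ·)
  map_one' := by ext; simp
  map_mul' x y := by ext; simp [mul_assoc]

theorem kun_aut_X {K : Type*} [Field K] {G : Type*} [Group G] (h : G) (q : MvPolynomial G K) :
    noetherAut K G h (algebraMap (MvPolynomial G K) (NoetherBigField K G) q) =
      algebraMap (MvPolynomial G K) (NoetherBigField K G) (MvPolynomial.rename (h * ·) q) := by
  unfold noetherAut
  rw [IsFractionRing.algEquivOfAlgEquiv_algebraMap]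
  rfl

theorem kun_ext {K : Type*} [Field K] {G : Type*} (σ τ : NoetherBigField K G ≃ₐ[K] NoetherBigField K G)
    (h : ∀ q : MvPolynomial G K, σ (algebraMap _ _ q) = τ (algebraMap _ _ q)) : σ = τ := by
  ext z
  obtain ⟨a, b, hb, rfl⟩ := IsFractionRing.div_surjective (A := MvPolynomial G K) z
  rw [map_div₀, map_div₀, h, h]

def kunHom (K : Type*) [Field K] (G : Type*) [Group G] :
    G →* (NoetherBigField K G ≃ₐ[K] NoetherBigField K G) where
  toFun := noetherAut K G
  map_one' := by
    apply kun_ext; intro q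
    rw [kun_aut_X]
    have : ((1 : G) * ·) = (id : G → G) := by ext; simp
    rw [this, MvPolynomial.rename_id]; rfl
  map_mul' x y := by
    apply kun_ext; intro q
    rw [AlgEquiv.mul_apply, kun_aut_X, kun_aut_X, kun_aut_X, MvPolynomial.rename_rename]
    congr 2
    ext g; simp [mul_assoc]

theorem kun_equivar {K : Type*} [Field K] {G : Type*} [Group G] (h : G) (v : G →₀ K) :
    kunHom K G h (kunLin K G v) = kunLin K G (kunRep K G h v) := by
  induction v using Finsupp.induction_linear with
  | zero => simp
  | add x y hx hy => simp only [map_add, hx, hy]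
  | single g a =>
    change noetherAut K G h _ = _
    simp [kunLin, kunRep, kun_aut_X]

theorem kun_span_top (K : Type*) [Field K] (G : Type*) :
    IntermediateField.adjoin K (kunLin K G '' ((⊤ : Submodule K (G →₀ K)) : Set (G →₀ K))) = ⊤ := by
  rw [eq_top_iff]
  rintro z -
  set E := IntermediateField.adjoin K
    (kunLin K G '' ((⊤ : Submodule K (G →₀ K)) : Set (G →₀ K)))
  have hq : ∀ q : MvPolynomial G K, algebraMap _ (NoetherBigField K G) q ∈ E := by
    intro q
    induction q using MvPolynomial.induction_on with
    | C a =>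
      have := E.algebraMap_mem a
      rwa [IsScalarTower.algebraMap_apply K (MvPolynomial G K)] at this
    | add x y hx hy => rw [map_add]; exact add_mem hx hy
    | mul_X x g hx =>
      rw [map_mul]
      exact mul_mem hx (IntermediateField.subset_adjoin _ _
        ⟨Finsupp.single g 1, trivial, by simp [kunLin]⟩)
  obtain ⟨a, b, hb, rfl⟩ := IsFractionRing.div_surjective (A := MvPolynomial G K) z
  exact div_mem (hq a) (hq b)

/-- The inductive property. -/
def KunProp (K : Type*) [Field K] (G : Type*) [Group G] (W : Submodule K (G →₀ K)) : Prop :=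
  (∀ g, W ≤ W.comap (kunRep K G g)) ∧
  ∃ s : Set (NoetherBigField K G), s.Finite ∧ AlgebraicIndepOn K id s ∧
    ∀ u, u ∈ IntermediateField.adjoin K s ↔
      u ∈ IntermediateField.adjoin K (kunLin K G '' (W : Set (G →₀ K))) ∧
        ∀ g, kunHom K G g u = u

theorem kun_bot (K : Type*) [Field K] (G : Type*) [Group G] : KunProp K G ⊥ := by
  refine ⟨fun g => bot_le, ∅, Set.finite_empty, ?_, fun u => ?_⟩
  · rw [AlgebraicIndepOn, algebraicIndependent_empty_type_iff]
    exact (algebraMap K (NoetherBigField K G)).injective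
  · have : IntermediateField.adjoin K
        (kunLin K G '' ((⊥ : Submodule K (G →₀ K)) : Set (G →₀ K))) = ⊥ := by
      rw [IntermediateField.adjoin_eq_bot_iff]
      rintro _ ⟨w, hw, rfl⟩
      have : w = 0 := by simpa using hw
      rw [this, map_zero]
      exact zero_mem _
    rw [this, IntermediateField.adjoin_empty]
    refine ⟨fun h => ⟨h, fun g => ?_⟩, fun h => h.1⟩
    obtain ⟨c, rfl⟩ := IntermediateField.mem_bot.1 h
    exact AlgEquiv.commutes _ _

theorem kun_step {K : Type*} [Field K] {G : Type*} [Group G] [Finite G]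
    (W : Submodule K (G →₀ K)) (hW : KunProp K G W) (v : G →₀ K) (hv : v ∉ W)
    (hgv : ∀ g, kunRep K G g v - v ∈ W) : KunProp K G (W ⊔ Submodule.span K {v}) := by
  obtain ⟨hst, s, hfin, hind, hs⟩ := hW
  set L := IntermediateField.adjoin K (kunLin K G '' (W : Set (G →₀ K))) with hLdef
  have hL : ∀ g, ∀ a ∈ L, kunHom K G g a ∈ L := by
    intro g
    have : L ≤ L.comap (kunHom K G g : NoetherBigField K G →ₐ[K] NoetherBigField K G) := by
      rw [hLdef, IntermediateField.adjoin_le_iff]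
      rintro _ ⟨w, hw, rfl⟩
      change kunHom K G g _ ∈ IntermediateField.adjoin K (kunLin K G '' (W : Set (G →₀ K)))
      rw [kun_equivar]
      exact IntermediateField.subset_adjoin _ _ ⟨_, hst g hw, rfl⟩
    exact this
  obtain ⟨f, hft, hffix, hfmem, hmain⟩ := kun_miyata (kunHom K G) L hL (kunLin K G v)
    (kun_trans W v hv) (fun g => by
      rw [kun_equivar, ← map_sub]
      exact IntermediateField.subset_adjoin _ _ ⟨_, hgv g, rfl⟩)
  have hL' : IntermediateField.adjoin K (kunLin K G '' ((W ⊔ Submodule.span K {v} :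
      Submodule K (G →₀ K)) : Set (G →₀ K))) =
      (IntermediateField.adjoin L {kunLin K G v}).restrictScalars K := by
    rw [hLdef, IntermediateField.adjoin_adjoin_left]
    apply le_antisymm
    · rw [IntermediateField.adjoin_le_iff]
      rintro _ ⟨w, hw, rfl⟩
      obtain ⟨w, hw1, y, hy, rfl⟩ := Submodule.mem_sup.1 hw
      obtain ⟨c, rfl⟩ := Submodule.mem_span_singleton.1 hy
      rw [map_add, map_smul]
      refine add_mem (IntermediateField.subset_adjoin _ _ (Or.inl ⟨w, hw1, rfl⟩)) ?_
      apply IntermediateField.smul_mem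
      exact IntermediateField.subset_adjoin _ _ (Set.mem_union_right _ (Set.mem_singleton _))
    · refine IntermediateField.adjoin.mono _ _ _ ?_
      rintro _ (⟨w, hw, rfl⟩ | rfl)
      · exact ⟨w, Submodule.mem_sup_left hw, rfl⟩
      · exact ⟨v, Submodule.mem_sup_right (Submodule.mem_span_singleton_self v), rfl⟩
  refine ⟨?_, insert f s, hfin.insert f, ?_, ?_⟩
  · intro g
    refine sup_le (fun w hw => Submodule.mem_sup_left (hst g hw)) ?_
    rw [Submodule.span_singleton_le_iff_mem]
    rw [Submodule.mem_comap, ← sub_add_cancel (kunRep K G g v) v]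
    exact add_mem (Submodule.mem_sup_left (hgv g))
      (Submodule.mem_sup_right (Submodule.mem_span_singleton_self v))
  · refine hind.insert ?_
    rw [Set.image_id, id, ← IntermediateField.transcendental_adjoin_iff]
    have hle : IntermediateField.adjoin K s ≤ L := fun u hu => ((hs u).1 hu).1
    let := (IntermediateField.inclusion hle).toAlgebra
    have : IsScalarTower (IntermediateField.adjoin K s) L (NoetherBigField K G) :=
      IsScalarTower.of_algebraMap_eq fun _ => rfl
    exact hft.restrictScalars (algebraMap (IntermediateField.adjoin K s) L).injective
  · intro u
    rw [hL', IntermediateField.mem_restrictScalars]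
    constructor
    · intro hu
      have h1 : ∀ y ∈ insert f s, y ∈ IntermediateField.adjoin L {kunLin K G v} ∧
          ∀ g, kunHom K G g y = y := by
        rintro y (rfl | hy)
        · exact ⟨hfmem, hffix⟩
        · have := (hs y).1 (IntermediateField.subset_adjoin _ _ hy)
          exact ⟨IntermediateField.algebraMap_mem _ (⟨y, this.1⟩ : L), this.2⟩
      constructor
      · have : IntermediateField.adjoin K (insert f s) ≤
          (IntermediateField.adjoin L {kunLin K G v}).restrictScalars K :=
          IntermediateField.adjoin_le_iff.2 fun y hy => (h1 y hy).1
        exact this hu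
      · intro g
        induction hu using IntermediateField.adjoin_induction with
        | mem x hx => exact (h1 x hx).2 g
        | algebraMap c => exact AlgEquiv.commutes _ _
        | add x y _ _ hx hy => rw [map_add, hx, hy]
        | inv x _ hx => rw [map_inv₀, hx]
        | mul x y _ _ hx hy => rw [map_mul, hx, hy]
    · rintro ⟨hu, hfix⟩
      have h2 := hmain u hu hfix
      refine IntermediateField.adjoin_le_iff.2 ?_ h2
      rintro y (⟨hy, hy'⟩ | rfl)
      · exact IntermediateField.adjoin.mono _ _ _ (Set.subset_insert _ _) ((hs y).2 ⟨hy, hy'⟩)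
      · exact IntermediateField.subset_adjoin _ _ (Set.mem_insert _ _)

theorem kun_top {K : Type*} [Field K] (p : ℕ) (hp : p.Prime) [CharP K p]
    (G : Type*) [Group G] [Finite G] (hG : IsPGroup p G) : KunProp K G ⊤ := by
  obtain ⟨W, hW, hmax⟩ := set_has_maximal_iff_noetherian.2
    (inferInstance : IsNoetherian K (G →₀ K)) {W | KunProp K G W} ⟨⊥, kun_bot K G⟩
  by_cases h : W = ⊤
  · rw [← h]; exact hW
  obtain ⟨v, hv, hgv⟩ := kun_next p hp hG (kunRep K G) W hW.1 h
  refine absurd ?_ (hmax _ (kun_step W hW v hv hgv))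
  refine lt_of_le_of_ne le_sup_left fun h => hv ?_
  rw [h]
  exact Submodule.mem_sup_right (Submodule.mem_span_singleton_self v)

/-- Kuniyoshi's theorem: if `char K = p > 0` and `G` is a finite `p`-group, then `K(G)` is
rational over `K`. -/
theorem kuniyoshi_noether_rational
    (K : Type*) [Field K] (p : ℕ) (hp : p.Prime) [CharP K p]
    (G : Type*) [Group G] [Finite G] (hG : IsPGroup p G) :
    IsRationalExtension K (NoetherField K G) := by
  obtain ⟨-, s, hfin, hind, hs⟩ := kun_top (K := K) p hp G hG
  have := hfin.to_subtype
  have hs' : ∀ u, u ∈ IntermediateField.adjoin K s ↔ u ∈ noetherSubfield K G := by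
    intro u
    rw [hs u, kun_span_top]
    exact ⟨fun h => h.2, fun h => ⟨trivial, h⟩⟩
  have hr : Set.range (fun i : s => id (i : NoetherBigField K G)) = s := by simp
  let e0 : IntermediateField.adjoin K (Set.range (fun i : s => id (i : NoetherBigField K G))) ≃ₐ[K]
      IntermediateField.adjoin K s := IntermediateField.equivOfEq (by rw [hr])
  let e1 : NoetherField K G ≃ₐ[K] IntermediateField.adjoin K s :=
    { toFun := fun x => ⟨x.1, (hs' _).2 x.2⟩
      invFun := fun x => ⟨x.1, (hs' _).1 x.2⟩
      left_inv := fun _ => rfl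
      right_inv := fun _ => rfl
      map_mul' := fun _ _ => rfl
      map_add' := fun _ _ => rfl
      commutes' := fun _ => rfl }
  let e2 : FractionRing (MvPolynomial s K) ≃ₐ[K] FractionRing (MvPolynomial (Fin (Nat.card s)) K) :=
    IsFractionRing.algEquivOfAlgEquiv (MvPolynomial.renameEquiv K (Finite.equivFin s))
  exact ⟨Nat.card s, ⟨(e1.trans e0.symm).trans
    ((AlgebraicIndependent.aevalEquivField hind).symm.trans e2)⟩⟩

end
end
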